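/- Let $A$ be a finitely generated commutative unital $\mathbb{C}$-algebra and $\mathfrak{q} = \mathfrak{q}(n)$, $n \geq 2$. The map $\Psi \mapsto \widehat{\ev}_\Psi$ is a bijection from the set $\mathcal{E}(\mathfrak{q},A)$ of finitely supported functions $\mathrm{MaxSpec}(A) \to \mathcal{R}(\mathfrak{q})$ to the set of isomorphism classes of irreducible finite-dimensional representations of $\mathfrak{q} \otimes A$. -/

import Mathlib

open Matrix

noncomputable section

variable (n : ℕ) (A : Type*) [CommRing A] [Algebra ℂ A]

/-- Square matrices of size `n+1` with entries in the commutative `ℂ`-algebra `A`. -/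
abbrev QMat := Matrix (Fin (n + 1)) (Fin (n + 1)) A

/-- The ambient space of pairs `(X, Y)` of matrices over `A`; a pair represents the
element of `𝔮(n) ⊗ A` with even component `X` and odd component `Y` (using the
identification of `𝔮(n) ⊗ A` with pairs of traceless `(n+1) × (n+1)` matrices over
`A`, where `(X, Y)` corresponds to the class of `[[X, Y], [Y, X]]`). -/
abbrev QPair := QMat n A × QMat n A

/-- `𝔮(n) ⊗ A`, realized as the space of pairs of traceless matrices over `A`. -/
def qA : Submodule ℂ (QPair n A) where
  carrier := {p | p.1.trace = 0 ∧ p.2.trace = 0}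
  add_mem' := by
    intro p q hp hq
    exact ⟨by simp [hp.1, hq.1], by simp [hp.2, hq.2]⟩
  zero_mem' := by simp
  smul_mem' := by
    intro c p hp
    exact ⟨by simp [hp.1], by simp [hp.2]⟩

/-- The Lie superbracket of `𝔮(n) ⊗ A` in the matrix-pair model: on even components it
is the commutator plus the anticommutator of the odd components (projected back to
traceless matrices), and on odd components it is given by the mixed commutators. -/
def qbr (p q : QPair n A) : QPair n A :=
  (p.1 * q.1 - q.1 * p.1 + p.2 * q.2 + q.2 * p.2 -
      (((n : ℂ) + 1)⁻¹ • (p.2 * q.2 + q.2 * p.2).trace) • (1 : QMat n A),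
    p.1 * q.2 - q.2 * p.1 + p.2 * q.1 - q.1 * p.2)

lemma qbr_mem (p q : QPair n A) : qbr n A p q ∈ qA n A := by
  have h1 : ((((n : ℂ) + 1)⁻¹ • (p.2 * q.2 + q.2 * p.2).trace) •
      (1 : QMat n A)).trace = (p.2 * q.2 + q.2 * p.2).trace := by
    rw [Matrix.trace_smul, Matrix.trace_one, smul_eq_mul, smul_mul_assoc]
    rw [show ((Fintype.card (Fin (n + 1)) : A)) = ((n + 1 : ℕ) : A) by simp]
    rw [← nsmul_eq_mul', ← Nat.cast_smul_eq_nsmul ℂ, smul_smul]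
    rw [show (((n + 1 : ℕ) : ℂ)) = (n : ℂ) + 1 by push_cast; ring]
    rw [inv_mul_cancel₀ (by
      exact_mod_cast Nat.cast_add_one_ne_zero (R := ℂ) n), one_smul]
  constructor
  · show (p.1 * q.1 - q.1 * p.1 + p.2 * q.2 + q.2 * p.2 -
      (((n : ℂ) + 1)⁻¹ • (p.2 * q.2 + q.2 * p.2).trace) • (1 : QMat n A)).trace = 0
    rw [Matrix.trace_sub, h1, Matrix.trace_add, Matrix.trace_add, Matrix.trace_sub,
      Matrix.trace_add, Matrix.trace_mul_comm p.1 q.1]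
    ring
  · show (p.1 * q.2 - q.2 * p.1 + p.2 * q.1 - q.1 * p.2).trace = 0
    rw [Matrix.trace_sub, Matrix.trace_add, Matrix.trace_sub,
      Matrix.trace_mul_comm p.1 q.2, Matrix.trace_mul_comm p.2 q.1]
    ring

/-- An element of the matrix-pair model is even if its odd component vanishes. -/
def IsEvenElt (p : QPair n A) : Prop := p.2 = 0

/-- An element of the matrix-pair model is odd if its even component vanishes. -/
def IsOddElt (p : QPair n A) : Prop := p.1 = 0

/-- Membership in `𝔥₀ ⊗ A`: even, with diagonal matrix component. -/
def InH0 (p : QPair n A) : Prop := p.2 = 0 ∧ p.1.IsDiag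

/-- Membership in `𝔥₁ ⊗ A`: odd, with diagonal matrix component. -/
def InH1 (p : QPair n A) : Prop := p.1 = 0 ∧ p.2.IsDiag

/-- Membership in `𝔥 ⊗ A`: both components diagonal. -/
def InH (p : QPair n A) : Prop := p.1.IsDiag ∧ p.2.IsDiag

/-- Membership in `𝔫⁺ ⊗ A`: both components strictly upper triangular. -/
def InNplus (p : QPair n A) : Prop :=
  ∀ i j : Fin (n + 1), j ≤ i → p.1 i j = 0 ∧ p.2 i j = 0

/-- Membership in `𝔮(n) ⊗ I` for an ideal `I ⊆ A`: all entries lie in `I`. -/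
def EntriesIn (I : Ideal A) (p : QPair n A) : Prop :=
  ∀ i j : Fin (n + 1), p.1 i j ∈ I ∧ p.2 i j ∈ I

/-- `𝔥₀ ⊗ A` as a subspace of the matrix-pair model of `𝔮(n) ⊗ A`: even diagonal
traceless pairs. -/
def h0A : Submodule ℂ (QPair n A) where
  carrier := {p | p.2 = 0 ∧ p.1.IsDiag ∧ p.1.trace = 0}
  add_mem' := by
    intro p q hp hq
    exact ⟨by simp [hp.1, hq.1], hp.2.1.add hq.2.1, by simp [hp.2.2, hq.2.2]⟩
  zero_mem' := ⟨rfl, Matrix.isDiag_zero, by simp⟩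
  smul_mem' := by
    intro c p hp
    exact ⟨by simp [hp.1], hp.2.1.smul c, by simp [hp.2.2]⟩

lemma h0A_le_qA : h0A n A ≤ qA n A := by
  intro p hp
  exact ⟨hp.2.2, by simp [hp.1]⟩

/-- The raw data of an action of `𝔮(n) ⊗ A` on a `ℤ₂`-graded vector space `M`: an
action map and the parity involution `P` of `M`. -/
structure QAct (M : Type*) [AddCommGroup M] [Module ℂ M] where
  act : ↥(qA n A) →ₗ[ℂ] M →ₗ[ℂ] M
  P : M →ₗ[ℂ] M

variable {M : Type*} [AddCommGroup M] [Module ℂ M]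

/-- The data `ρ` is a representation of the Lie superalgebra `𝔮(n) ⊗ A`: `P` is an
involution, commuting (resp. anticommuting) with the action of even (resp. odd)
elements, and the bracket acts by the supercommutator. -/
def QAct.IsRep (ρ : QAct n A M) : Prop :=
  (ρ.P ∘ₗ ρ.P = LinearMap.id) ∧
  (∀ x : ↥(qA n A), IsEvenElt n A ↑x → ρ.P ∘ₗ ρ.act x = ρ.act x ∘ₗ ρ.P) ∧
  (∀ x : ↥(qA n A), IsOddElt n A ↑x → ρ.P ∘ₗ ρ.act x = -(ρ.act x ∘ₗ ρ.P)) ∧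
  (∀ x y : ↥(qA n A), (IsEvenElt n A ↑x ∨ IsEvenElt n A ↑y) →
    ρ.act ⟨qbr n A ↑x ↑y, qbr_mem n A _ _⟩ = ρ.act x ∘ₗ ρ.act y - ρ.act y ∘ₗ ρ.act x) ∧
  (∀ x y : ↥(qA n A), IsOddElt n A ↑x → IsOddElt n A ↑y →
    ρ.act ⟨qbr n A ↑x ↑y, qbr_mem n A _ _⟩ = ρ.act x ∘ₗ ρ.act y + ρ.act y ∘ₗ ρ.act x)

/-- A graded submodule: stable under the action and under the parity involution. -/
def QAct.Invt (ρ : QAct n A M) (N : Submodule ℂ M) : Prop :=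
  (∀ x : ↥(qA n A), ∀ m ∈ N, ρ.act x m ∈ N) ∧ ∀ m ∈ N, ρ.P m ∈ N

/-- Irreducibility: `M ≠ 0` and the only graded invariant subspaces are `0`, `M`. -/
def QAct.Irred (ρ : QAct n A M) : Prop :=
  Nontrivial M ∧ ∀ N : Submodule ℂ M, QAct.Invt n A ρ N → N = ⊥ ∨ N = ⊤

/-- The `U(𝔮(n) ⊗ A)`-submodule of `M` generated by `v`: the smallest subspace
containing `v` and stable under the action. -/
def QAct.gen (ρ : QAct n A M) (v : M) : Submodule ℂ M :=
  sInf {N | v ∈ N ∧ ∀ x : ↥(qA n A), ∀ m ∈ N, ρ.act x m ∈ N}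

/-- `v` is a highest weight vector of `ρ` with highest weight `ψ : 𝔥₀ ⊗ A → ℂ`:
`v ≠ 0`, `v` generates `M` (i.e. `U(𝔮 ⊗ A)v = M`), `(𝔫⁺ ⊗ A)v = 0` and every element
of `𝔥₀ ⊗ A` acts on `v` by the scalar given by `ψ` (i.e. `U(𝔥₀ ⊗ A)v = ℂv`). -/
def QAct.IsHWVector (ρ : QAct n A M) (ψ : ↥(h0A n A) →ₗ[ℂ] ℂ) (v : M) : Prop :=
  v ≠ 0 ∧ QAct.gen n A ρ v = ⊤ ∧
  (∀ x : ↥(qA n A), InNplus n A ↑x → ρ.act x v = 0) ∧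
  (∀ (p : QPair n A) (hp : p ∈ h0A n A),
    ρ.act ⟨p, h0A_le_qA n A hp⟩ v = ψ ⟨p, hp⟩ • v)

/-- `ψ ∈ 𝓛(𝔥 ⊗ A)`: a functional on `𝔥₀ ⊗ A` vanishing on `𝔥₀ ⊗ I` for some
finite-codimensional ideal `I ⊆ A`. -/
def LFun (ψ : ↥(h0A n A) →ₗ[ℂ] ℂ) : Prop :=
  ∃ I : Ideal A, FiniteDimensional ℂ (A ⧸ I) ∧
    ∀ x : ↥(h0A n A), EntriesIn n A I ↑x → ψ x = 0

open TensorProduct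

/-- The even component of an element of `𝔮(n) ⊗ A` (projection killing the odd part). -/
def evenPartL : ↥(qA n A) →ₗ[ℂ] ↥(qA n A) where
  toFun x := ⟨((x : QPair n A).1, 0), ⟨x.2.1, by simp⟩⟩
  map_add' x y := by ext <;> simp
  map_smul' c x := by ext <;> simp

/-- The odd component of an element of `𝔮(n) ⊗ A`. -/
def oddPartL : ↥(qA n A) →ₗ[ℂ] ↥(qA n A) where
  toFun x := ⟨(0, (x : QPair n A).2), ⟨by simp, x.2.2⟩⟩
  map_add' x y := by ext <;> simp
  map_smul' c x := by ext <;> simp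

variable {M1 M2 : Type*} [AddCommGroup M1] [Module ℂ M1]
  [AddCommGroup M2] [Module ℂ M2]

/-- The action of `𝔮(n) ⊗ A` on the tensor product of two graded modules, with the
super sign rule `x (m ⊗ m') = (x m) ⊗ m' + (-1)^{|x||m|} m ⊗ (x m')`, expressed via
the parity involution of the first factor and the even/odd components of `x`. -/
def tActL (ρ1 : QAct n A M1) (ρ2 : QAct n A M2) :
    ↥(qA n A) →ₗ[ℂ] M1 ⊗[ℂ] M2 →ₗ[ℂ] M1 ⊗[ℂ] M2 where
  toFun x :=
    TensorProduct.map (ρ1.act x) LinearMap.id +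
      TensorProduct.map LinearMap.id (ρ2.act (evenPartL n A x)) +
      TensorProduct.map ρ1.P (ρ2.act (oddPartL n A x))
  map_add' x y := by
    simp only [map_add, TensorProduct.map_add_left, TensorProduct.map_add_right]
    abel
  map_smul' c x := by
    simp only [LinearMap.map_smul, _root_.map_smul, TensorProduct.map_smul_left,
      TensorProduct.map_smul_right, RingHom.id_apply, smul_add]

/-- A bundled `ℤ₂`-graded `𝔮(n) ⊗ A`-module. -/
structure QModB (n : ℕ) (A : Type) [CommRing A] [Algebra ℂ A] where
  M : Type
  [i1 : AddCommGroup M]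
  [i2 : Module ℂ M]
  ρ : QAct n A M

attribute [instance] QModB.i1 QModB.i2

variable {B : Type} [CommRing B] [Algebra ℂ B]

/-- The tensor product of two bundled graded `𝔮(n) ⊗ A`-modules, with the diagonal
super action and the tensor product parity involution. -/
def tensQ (U V : QModB n B) : QModB n B :=
  ⟨U.M ⊗[ℂ] V.M, { act := tActL n B U.ρ V.ρ, P := TensorProduct.map U.ρ.P V.ρ.P }⟩

/-- The trivial one-dimensional (purely even) module `ℂ`. -/
def trivQ : QModB n B := ⟨ℂ, { act := 0, P := LinearMap.id }⟩

/-- The iterated (left-nested) super tensor product of a family of bundled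
`𝔮(n) ⊗ A`-modules. -/
def itTens : (k : ℕ) → (Fin k → QModB n B) → QModB n B
  | 0, _ => trivQ n
  | k + 1, Vs => tensQ n (itTens k fun i => Vs i.castSucc) (Vs (Fin.last k))

/-- `V` is supported at the maximal ideal `m`: it is annihilated by `𝔮 ⊗ m`, i.e. it
is (the pullback of) an evaluation module at `m`. -/
def SuppAt (m : Ideal B) (V : QModB n B) : Prop :=
  ∀ x : ↥(qA n B), EntriesIn n B m ↑x → V.ρ.act x = 0

/-- The action on `V` is trivial (`V` corresponds to the class `0 ∈ 𝓡(𝔮)`). -/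
def TrivialActs (V : QModB n B) : Prop := ∀ x : ↥(qA n B), V.ρ.act x = 0

/-- `W` is an irreducible (graded, invariant) submodule for the action `ρ`. -/
def QIrredSub {M : Type*} [AddCommGroup M] [Module ℂ M] (ρ : QAct n B M)
    (W : Submodule ℂ M) : Prop :=
  W ≠ ⊥ ∧ QAct.Invt n B ρ W ∧
    ∀ W' ≤ W, QAct.Invt n B ρ W' → W' = ⊥ ∨ W' = W

/-- Isomorphism of bundled `𝔮(n) ⊗ A`-modules (not necessarily homogeneous). -/
def QModIso (U V : QModB n B) : Prop :=
  ∃ e : U.M ≃ₗ[ℂ] V.M, ∀ (x : ↥(qA n B)) (u : U.M), e (U.ρ.act x u) = V.ρ.act x (e u)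

/-- An evaluation datum: pairwise distinct maximal ideals `ms i` together with
irreducible finite-dimensional nontrivial modules `Vs i` supported at `ms i`.  Such
data are in canonical bijection with the finitely supported functions
`Ψ : MaxSpec(A) → 𝓡(𝔮) ∖ {0}` of the paper (with `supp Ψ = {ms i}` and `Ψ(ms i)`
the class of `Vs i`). -/
def GoodData (k : ℕ) (ms : Fin k → Ideal B) (Vs : Fin k → QModB n B) : Prop :=
  (∀ i, (ms i).IsMaximal) ∧ Function.Injective ms ∧
    ∀ i, QAct.IsRep n B (Vs i).ρ ∧ QAct.Irred n B (Vs i).ρ ∧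
      FiniteDimensional ℂ (Vs i).M ∧ SuppAt n (ms i) (Vs i) ∧ ¬ TrivialActs n (Vs i)

/-- `V` realizes the irreducible product of evaluation representations
`ev_{ms}(Vs) = Vs 0 ⊗̂ ⋯ ⊗̂ Vs (k-1)`: it is isomorphic to an irreducible submodule
of the iterated super tensor product of the `Vs i`. -/
def Matches (k : ℕ) (ms : Fin k → Ideal B) (Vs : Fin k → QModB n B)
    (V : QModB n B) : Prop :=
  ∃ W : Submodule ℂ (itTens n k Vs).M, QIrredSub n (itTens n k Vs).ρ W ∧
    ∃ φ : V.M →ₗ[ℂ] (itTens n k Vs).M, Function.Injective ⇑φ ∧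
      LinearMap.range φ = W ∧
      ∀ (x : ↥(qA n B)) (v : V.M), φ (V.ρ.act x v) = (itTens n k Vs).ρ.act x (φ v)


/-! ### Scalar multiplication by elements of the coefficient algebra -/

/-- Multiplication by `b` on `𝔮(n) ⊗ B`. -/
def bs (b : B) : ↥(qA n B) →ₗ[ℂ] ↥(qA n B) where
  toFun x := ⟨(b • (x : QPair n B).1, b • (x : QPair n B).2),
    ⟨by simp [Matrix.trace_smul, x.2.1], by simp [Matrix.trace_smul, x.2.2]⟩⟩
  map_add' x y := by ext <;> simp [mul_add]
  map_smul' c x := by ext <;> simp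

/-- The bracket, as an element of `qA`. -/
abbrev brs (x y : ↥(qA n B)) : ↥(qA n B) := ⟨qbr n B ↑x ↑y, qbr_mem n B _ _⟩

lemma bs_add (a b : B) (x : ↥(qA n B)) : bs n (a + b) x = bs n a x + bs n b x := by
  ext <;> simp [bs, add_mul]

lemma bs_sub (a b : B) (x : ↥(qA n B)) : bs n (a - b) x = bs n a x - bs n b x := by
  ext <;> simp [bs, sub_mul]

lemma bs_mul (a b : B) (x : ↥(qA n B)) : bs n (a * b) x = bs n a (bs n b x) := by
  ext <;> simp [bs, mul_assoc]

lemma bs_one (x : ↥(qA n B)) : bs n 1 x = x := by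
  ext <;> simp [bs]

lemma bs_smul (c : ℂ) (a : B) (x : ↥(qA n B)) : bs n (c • a) x = c • bs n a x := by
  ext <;> simp [bs]

lemma bs_brs (a b : B) (x y : ↥(qA n B)) :
    brs n (bs n a x) (bs n b y) = bs n (a * b) (brs n x y) := by
  apply Subtype.ext
  apply Prod.ext
  · simp only [brs, bs, qbr, LinearMap.coe_mk, AddHom.coe_mk, smul_sub, smul_add,
      Matrix.smul_mul, Matrix.mul_smul, smul_smul, Matrix.trace_add, Matrix.trace_smul]
    rw [mul_comm b a]
    congr 1
    simp only [smul_eq_mul, mul_add, mul_smul_comm, smul_add]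
  · simp only [brs, bs, qbr, LinearMap.coe_mk, AddHom.coe_mk, smul_sub, smul_add,
      Matrix.smul_mul, Matrix.mul_smul, smul_smul]
    rw [mul_comm b a]

lemma bs_entries (I : Ideal B) {d : B} (hd : d ∈ I) (x : ↥(qA n B)) :
    EntriesIn n B I ↑(bs n d x) := by
  intro i j
  exact ⟨by simpa [bs] using I.mul_mem_right _ hd, by simpa [bs] using I.mul_mem_right _ hd⟩

lemma bs_entries' (I J : Ideal B) {d : B} (hd : d ∈ I) (x : ↥(qA n B))
    (hx : EntriesIn n B J ↑x) : EntriesIn n B (I ⊓ J) ↑(bs n d x) := by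
  intro i j
  exact ⟨⟨by simpa [bs] using I.mul_mem_right _ hd,
      by simpa [bs] using J.mul_mem_left _ (hx i j).1⟩,
    ⟨by simpa [bs] using I.mul_mem_right _ hd,
      by simpa [bs] using J.mul_mem_left _ (hx i j).2⟩⟩

lemma bs_even {x : ↥(qA n B)} (b : B) (hx : IsEvenElt n B ↑x) :
    IsEvenElt n B ↑(bs n b x) := by
  simp only [IsEvenElt] at *
  simp [bs, hx]

lemma bs_odd {x : ↥(qA n B)} (b : B) (hx : IsOddElt n B ↑x) :
    IsOddElt n B ↑(bs n b x) := by
  simp only [IsOddElt] at *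
  simp [bs, hx]

lemma isEven_evenPartL (x : ↥(qA n A)) : IsEvenElt n A ↑(evenPartL n A x) := rfl

lemma isOdd_oddPartL (x : ↥(qA n A)) : IsOddElt n A ↑(oddPartL n A x) := rfl

lemma evenPartL_of_even {x : ↥(qA n A)} (hx : IsEvenElt n A ↑x) : evenPartL n A x = x := by
  apply Subtype.ext
  exact Prod.ext rfl hx.symm

lemma evenPartL_of_odd {x : ↥(qA n A)} (hx : IsOddElt n A ↑x) : evenPartL n A x = 0 := by
  apply Subtype.ext
  exact Prod.ext hx rfl

lemma oddPartL_of_odd {x : ↥(qA n A)} (hx : IsOddElt n A ↑x) : oddPartL n A x = x := by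
  apply Subtype.ext
  exact Prod.ext hx.symm rfl

lemma oddPartL_of_even {x : ↥(qA n A)} (hx : IsEvenElt n A ↑x) : oddPartL n A x = 0 := by
  apply Subtype.ext
  exact Prod.ext rfl hx

lemma even_add_odd (x : ↥(qA n A)) : evenPartL n A x + oddPartL n A x = x := by
  apply Subtype.ext
  exact Prod.ext (add_zero _) (zero_add _)

lemma evenPartL_bs (b : B) (x : ↥(qA n B)) :
    evenPartL n B (bs n b x) = bs n b (evenPartL n B x) := by
  apply Subtype.ext
  exact Prod.ext rfl (smul_zero _).symm

lemma oddPartL_bs (b : B) (x : ↥(qA n B)) :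
    oddPartL n B (bs n b x) = bs n b (oddPartL n B x) := by
  apply Subtype.ext
  exact Prod.ext (smul_zero _).symm rfl

/-- The bracket of an even and an odd element is odd, etc. -/
lemma brs_even_even {x y : ↥(qA n B)} (hx : IsEvenElt n B ↑x) (hy : IsEvenElt n B ↑y) :
    IsEvenElt n B ↑(brs n x y) := by
  simp only [IsEvenElt] at *
  simp [qbr, hx, hy]

lemma brs_odd_odd {x y : ↥(qA n A)} (hx : IsOddElt n A ↑x) (hy : IsOddElt n A ↑y) :
    IsEvenElt n A (qbr n A ↑x ↑y) := by
  simp only [IsEvenElt, IsOddElt] at *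
  simp [qbr, hx, hy]

lemma evenPartL_brs_left {x y : ↥(qA n A)} (hx : IsEvenElt n A ↑x) :
    evenPartL n A ⟨qbr n A ↑x ↑y, qbr_mem n A _ _⟩ =
      ⟨qbr n A ↑x ↑(evenPartL n A y), qbr_mem n A _ _⟩ := by
  simp only [IsEvenElt] at hx
  apply Subtype.ext
  apply Prod.ext <;> simp [qbr, hx, evenPartL]

lemma oddPartL_brs_left {x y : ↥(qA n A)} (hx : IsEvenElt n A ↑x) :
    oddPartL n A ⟨qbr n A ↑x ↑y, qbr_mem n A _ _⟩ =
      ⟨qbr n A ↑x ↑(oddPartL n A y), qbr_mem n A _ _⟩ := by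
  simp only [IsEvenElt] at hx
  apply Subtype.ext
  apply Prod.ext <;> simp [qbr, hx, oddPartL]

lemma evenPartL_brs_right {x y : ↥(qA n A)} (hy : IsEvenElt n A ↑y) :
    evenPartL n A ⟨qbr n A ↑x ↑y, qbr_mem n A _ _⟩ =
      ⟨qbr n A ↑(evenPartL n A x) ↑y, qbr_mem n A _ _⟩ := by
  simp only [IsEvenElt] at hy
  apply Subtype.ext
  apply Prod.ext <;> simp [qbr, hy, evenPartL]

lemma oddPartL_brs_right {x y : ↥(qA n A)} (hy : IsEvenElt n A ↑y) :
    oddPartL n A ⟨qbr n A ↑x ↑y, qbr_mem n A _ _⟩ =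
      ⟨qbr n A ↑(oddPartL n A x) ↑y, qbr_mem n A _ _⟩ := by
  simp only [IsEvenElt] at hy
  apply Subtype.ext
  apply Prod.ext <;> simp [qbr, hy, oddPartL]

/-- An element-free form of the definition of a representation. -/
structure RepFacts (ρ : QAct n A M) : Prop where
  PP : ∀ v, ρ.P (ρ.P v) = v
  Pev : ∀ x : ↥(qA n A), IsEvenElt n A ↑x → ∀ v, ρ.P (ρ.act x v) = ρ.act x (ρ.P v)
  Pod : ∀ x : ↥(qA n A), IsOddElt n A ↑x → ∀ v, ρ.P (ρ.act x v) = -ρ.act x (ρ.P v)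
  bre : ∀ x y : ↥(qA n A), (IsEvenElt n A ↑x ∨ IsEvenElt n A ↑y) → ∀ v,
    ρ.act ⟨qbr n A ↑x ↑y, qbr_mem n A _ _⟩ v = ρ.act x (ρ.act y v) - ρ.act y (ρ.act x v)
  bro : ∀ x y : ↥(qA n A), IsOddElt n A ↑x → IsOddElt n A ↑y → ∀ v,
    ρ.act ⟨qbr n A ↑x ↑y, qbr_mem n A _ _⟩ v = ρ.act x (ρ.act y v) + ρ.act y (ρ.act x v)

lemma repFacts_iff (ρ : QAct n A M) : QAct.IsRep n A ρ ↔ RepFacts n A ρ := by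
  constructor
  · rintro ⟨h1, h2, h3, h4, h5⟩
    exact ⟨fun v => LinearMap.congr_fun h1 v, fun x hx v => LinearMap.congr_fun (h2 x hx) v,
      fun x hx v => LinearMap.congr_fun (h3 x hx) v,
      fun x y h v => LinearMap.congr_fun (h4 x y h) v,
      fun x y h h' v => LinearMap.congr_fun (h5 x y h h') v⟩
  · rintro ⟨h1, h2, h3, h4, h5⟩
    exact ⟨LinearMap.ext h1, fun x hx => LinearMap.ext (h2 x hx),
      fun x hx => LinearMap.ext (h3 x hx),
      fun x y h => LinearMap.ext (h4 x y h),
      fun x y h h' => LinearMap.ext (h5 x y h h')⟩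

lemma act_split (ρ : QAct n A M) (x : ↥(qA n A)) (v : M) :
    ρ.act x v = ρ.act (evenPartL n A x) v + ρ.act (oddPartL n A x) v := by
  conv_lhs => rw [← even_add_odd n A x]
  simp

lemma RepFacts.P_act {ρ : QAct n A M} (h : RepFacts n A ρ) (x : ↥(qA n A)) (v : M) :
    ρ.P (ρ.act x v) =
      ρ.act (evenPartL n A x) (ρ.P v) - ρ.act (oddPartL n A x) (ρ.P v) := by
  rw [act_split, map_add, h.Pev _ (isEven_evenPartL n A x), h.Pod _ (isOdd_oddPartL n A x)]
  abel

/-- The action twisted by multiplication by `b`. -/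
def QAct.tw (ρ : QAct n B M) (b : B) : QAct n B M := ⟨ρ.act ∘ₗ bs n b, ρ.P⟩

lemma tw_act (ρ : QAct n B M) (b : B) (x : ↥(qA n B)) :
    (QAct.tw n ρ b).act x = ρ.act (bs n b x) := rfl

lemma tw_P (ρ : QAct n B M) (b : B) : (QAct.tw n ρ b).P = ρ.P := rfl

lemma RepFacts.tw {ρ : QAct n B M} (h : RepFacts n B ρ) (c : B)
    (hc : ∀ x, ρ.act (bs n (c * c) x) = ρ.act (bs n c x)) : RepFacts n B (QAct.tw n ρ c) where
  PP := h.PP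
  Pev x hx := h.Pev _ (bs_even n c hx)
  Pod x hx := h.Pod _ (bs_odd n c hx)
  bre x y hxy v := by
    rw [tw_act, tw_act, tw_act, ← h.bre _ _ (hxy.imp (bs_even n c) (bs_even n c))]
    rw [← hc]
    exact congrArg (fun z => ρ.act z v) (bs_brs n c c x y).symm
  bro x y hx hy v := by
    rw [tw_act, tw_act, tw_act, ← h.bro _ _ (bs_odd n c hx) (bs_odd n c hy)]
    rw [← hc]
    exact congrArg (fun z => ρ.act z v) (bs_brs n c c x y).symm

/-- Restriction to an invariant subspace. -/
def QAct.sub (ρ : QAct n A M) (W : Submodule ℂ M) (hW : QAct.Invt n A ρ W) : QAct n A W where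
  act :=
    { toFun := fun x => (ρ.act x).restrict (fun m hm => hW.1 x m hm)
      map_add' := by intro x y; ext; simp
      map_smul' := by intro x y; ext; simp }
  P := ρ.P.restrict hW.2

lemma sub_act (ρ : QAct n A M) (W : Submodule ℂ M) (hW : QAct.Invt n A ρ W)
    (x : ↥(qA n A)) (w : W) : ((QAct.sub n A ρ W hW).act x w : M) = ρ.act x w := rfl

lemma sub_P (ρ : QAct n A M) (W : Submodule ℂ M) (hW : QAct.Invt n A ρ W)
    (w : W) : ((QAct.sub n A ρ W hW).P w : M) = ρ.P w := rfl

lemma RepFacts.sub {ρ : QAct n A M} (h : RepFacts n A ρ) (W : Submodule ℂ M)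
    (hW : QAct.Invt n A ρ W) : RepFacts n A (QAct.sub n A ρ W hW) where
  PP v := Subtype.ext (h.PP v)
  Pev x hx v := Subtype.ext (h.Pev x hx v)
  Pod x hx v := Subtype.ext (h.Pod x hx v)
  bre x y hxy v := Subtype.ext (h.bre x y hxy v)
  bro x y hx hy v := Subtype.ext (h.bro x y hx hy v)

lemma sub_irred {ρ : QAct n B M} {W : Submodule ℂ M} (hW : QIrredSub n ρ W) :
    QAct.Irred n B (QAct.sub n B ρ W hW.2.1) := by
  refine ⟨Submodule.nontrivial_iff_ne_bot.2 hW.1, fun N hN => ?_⟩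
  have hinv : QAct.Invt n B ρ (N.map W.subtype) := by
    constructor
    · rintro x _ ⟨m, hm, rfl⟩
      exact ⟨_, hN.1 x m hm, rfl⟩
    · rintro _ ⟨m, hm, rfl⟩
      exact ⟨_, hN.2 m hm, rfl⟩
  rcases hW.2.2 _ (Submodule.map_subtype_le W N) hinv with h | h
  · left
    apply Submodule.map_injective_of_injective W.injective_subtype
    rw [h, Submodule.map_bot]
  · right
    apply Submodule.map_injective_of_injective W.injective_subtype
    rw [h, Submodule.map_top, Submodule.range_subtype]

/-- Existence of irreducible submodules. -/
lemma exists_irredSub [FiniteDimensional ℂ M] (ρ : QAct n B M) (W : Submodule ℂ M)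
    (hW : QAct.Invt n B ρ W) (h0 : W ≠ ⊥) :
    ∃ S : Submodule ℂ M, S ≤ W ∧ QIrredSub n ρ S := by
  obtain ⟨S, hS, hmin⟩ := (wellFounded_lt (α := Submodule ℂ M)).has_min
    {S | S ≤ W ∧ S ≠ ⊥ ∧ QAct.Invt n B ρ S} ⟨W, le_rfl, h0, hW⟩
  refine ⟨S, hS.1, hS.2.1, hS.2.2, fun S' hle hinv => ?_⟩
  by_cases hb : S' = ⊥
  · exact Or.inl hb
  · right
    by_contra hne
    exact hmin S' ⟨hle.trans hS.1, hb, hinv⟩ (lt_of_le_of_ne hle hne)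

lemma tActL_tmul (ρ1 : QAct n A M1) (ρ2 : QAct n A M2) (x : ↥(qA n A)) (u : M1) (v : M2) :
    tActL n A ρ1 ρ2 x (u ⊗ₜ[ℂ] v) = ρ1.act x u ⊗ₜ v + u ⊗ₜ ρ2.act (evenPartL n A x) v +
      ρ1.P u ⊗ₜ ρ2.act (oddPartL n A x) v := rfl

/-- The tensor product of two representations is a representation. -/
lemma RepFacts.tens {ρ1 : QAct n A M1} {ρ2 : QAct n A M2} (h1 : RepFacts n A ρ1)
    (h2 : RepFacts n A ρ2) : RepFacts n A
      ({ act := tActL n A ρ1 ρ2, P := TensorProduct.map ρ1.P ρ2.P } : QAct n A (M1 ⊗[ℂ] M2)) where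
  PP v := by
    induction v with
    | zero => simp
    | add v w hv hw => simp only [map_add, hv, hw]
    | tmul u v => simp [h1.PP, h2.PP]
  Pev x hx v := by
    induction v with
    | zero => simp
    | add v w hv hw => simp only [map_add, hv, hw]
    | tmul u v =>
      simp [tActL, oddPartL_of_even n A hx, evenPartL_of_even n A hx, h1.Pev x hx, h2.Pev x hx]
  Pod x hx v := by
    induction v with
    | zero => simp
    | add v w hv hw => simp only [map_add, hv, hw, neg_add]
    | tmul u v =>
      simp [tActL, oddPartL_of_odd n A hx, evenPartL_of_odd n A hx, h1.Pod x hx, h2.Pod x hx,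
        TensorProduct.neg_tmul, TensorProduct.tmul_neg]
      abel
  bre x y hxy v := by
    induction v with
    | zero => simp
    | add v w hv hw => simp only [map_add, hv, hw]; abel
    | tmul u v =>
      rcases hxy with hx | hy
      · simp only [tActL_tmul, evenPartL_brs_left n A hx, oddPartL_brs_left n A hx,
          evenPartL_of_even n A hx, oddPartL_of_even n A hx, map_zero, LinearMap.zero_apply,
          TensorProduct.tmul_zero, add_zero, map_add, h1.bre x _ (Or.inl hx),
          h2.bre x _ (Or.inl hx), h1.Pev x hx, TensorProduct.sub_tmul, TensorProduct.tmul_sub]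
        abel
      · simp only [tActL_tmul, evenPartL_brs_right n A hy, oddPartL_brs_right n A hy,
          evenPartL_of_even n A hy, oddPartL_of_even n A hy, map_zero, LinearMap.zero_apply,
          TensorProduct.tmul_zero, add_zero, map_add, h1.bre _ y (Or.inr hy),
          h2.bre _ y (Or.inr hy), h1.Pev y hy, TensorProduct.sub_tmul, TensorProduct.tmul_sub]
        abel
  bro x y hx hy v := by
    induction v with
    | zero => simp
    | add v w hv hw => simp only [map_add, hv, hw]; abel
    | tmul u v =>
      have hxy : IsEvenElt n A
        ((⟨qbr n A ↑x ↑y, qbr_mem n A _ _⟩ : ↥(qA n A)) : QPair n A) := brs_odd_odd n A hx hy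
      simp only [tActL_tmul, evenPartL_of_even n A hxy, oddPartL_of_even n A hxy,
          evenPartL_of_odd n A hx, oddPartL_of_odd n A hx,
          evenPartL_of_odd n A hy, oddPartL_of_odd n A hy, map_zero, LinearMap.zero_apply,
          TensorProduct.tmul_zero, add_zero, map_add, h1.bro x y hx hy, h1.PP,
          h2.bro x y hx hy, h1.Pod x hx, h1.Pod y hy, TensorProduct.add_tmul,
          TensorProduct.neg_tmul, TensorProduct.tmul_add]
      abel

lemma RepFacts.triv : RepFacts n B (trivQ (B := B) n).ρ where
  PP v := rfl
  Pev x hx v := rfl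
  Pod x hx v := (neg_zero (G := ℂ)).symm
  bre x y hxy v := (sub_zero (0 : ℂ)).symm
  bro x y hx hy v := (add_zero (0 : ℂ)).symm

lemma RepFacts.itTens : ∀ (k : ℕ) (Vs : Fin k → QModB n B),
    (∀ i, RepFacts n B (Vs i).ρ) → RepFacts n B (itTens n k Vs).ρ
  | 0, _, _ => RepFacts.triv n
  | k + 1, Vs, h => RepFacts.tens n B (RepFacts.itTens k (fun i => Vs i.castSucc) fun i => h _)
      (h (Fin.last k))

lemma finDim_itTens : ∀ (k : ℕ) (Vs : Fin k → QModB n B),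
    (∀ i, FiniteDimensional ℂ (Vs i).M) → FiniteDimensional ℂ (itTens n k Vs).M
  | 0, _, _ => inferInstanceAs (FiniteDimensional ℂ ℂ)
  | k + 1, Vs, h => by
    have h1 := finDim_itTens k (fun i => Vs i.castSucc) fun i => h _
    have h2 := h (Fin.last k)
    exact inferInstanceAs (FiniteDimensional ℂ
      ((_root_.itTens n k (fun i => Vs i.castSucc)).M ⊗[ℂ] (Vs (Fin.last k)).M))

lemma nontrivial_itTens : ∀ (k : ℕ) (Vs : Fin k → QModB n B),
    (∀ i, Nontrivial (Vs i).M) → Nontrivial (itTens n k Vs).M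
  | 0, _, _ => inferInstanceAs (Nontrivial ℂ)
  | k + 1, Vs, h => by
    have h1 := nontrivial_itTens k (fun i => Vs i.castSucc) fun i => h _
    have h2 := h (Fin.last k)
    exact Module.FaithfullyFlat.lTensor_nontrivial ℂ (_root_.itTens n k (fun i => Vs i.castSucc)).M
      (Vs (Fin.last k)).M

/-- Part one of the theorem. -/
lemma part_one (k : ℕ) (ms : Fin k → Ideal B) (Vs : Fin k → QModB n B)
    (hg : GoodData n k ms Vs) :
      ∃ V : QModB n B, QAct.IsRep n B V.ρ ∧ QAct.Irred n B V.ρ ∧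
        FiniteDimensional ℂ V.M ∧ Matches n k ms Vs V := by
  have hr : RepFacts n B (itTens n k Vs).ρ :=
    RepFacts.itTens n k Vs fun i => (repFacts_iff n B _).1 (hg.2.2 i).1
  have hf : FiniteDimensional ℂ (itTens n k Vs).M := finDim_itTens n k Vs fun i =>
    (hg.2.2 i).2.2.1
  have hnt : Nontrivial (itTens n k Vs).M := nontrivial_itTens n k Vs fun i =>
    (hg.2.2 i).2.1.1
  obtain ⟨S, -, hS⟩ := exists_irredSub n (itTens n k Vs).ρ ⊤
    ⟨fun _ _ _ => trivial, fun _ _ => trivial⟩ top_ne_bot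
  exact ⟨⟨S, QAct.sub n B _ S hS.2.1⟩, (repFacts_iff n B _).2 (hr.sub n B S hS.2.1),
    sub_irred n hS, inferInstanceAs (FiniteDimensional ℂ S), S, hS, S.subtype,
    S.injective_subtype, S.range_subtype, fun x v => rfl⟩

/-! ### The Schur lemma and separating functionals -/

/-- A homogeneous nonzero intertwiner between irreducibles is bijective. -/
lemma bijective_of_homog {ρ1 : QAct n B M1} {ρ2 : QAct n B M2}
    (i1 : QAct.Irred n B ρ1) (i2 : QAct.Irred n B ρ2) (F : M1 →ₗ[ℂ] M2) (hF : F ≠ 0)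
    (hx : ∀ x v, F (ρ1.act x v) = ρ2.act x (F v)) (ε : ℂ) (hε : ε ≠ 0)
    (hP : ∀ v, F (ρ1.P v) = ε • ρ2.P (F v)) : Function.Bijective F := by
  have hk : QAct.Invt n B ρ1 (LinearMap.ker F) := by
    constructor
    · intro x m hm
      rw [LinearMap.mem_ker] at *
      rw [hx, hm, map_zero]
    · intro m hm
      rw [LinearMap.mem_ker] at *
      rw [hP, hm, map_zero, smul_zero]
  have hr : QAct.Invt n B ρ2 (LinearMap.range F) := by
    constructor
    · rintro x _ ⟨v, rfl⟩
      exact ⟨_, hx x v⟩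
    · rintro _ ⟨v, rfl⟩
      refine ⟨ε⁻¹ • ρ1.P v, ?_⟩
      rw [map_smul, hP, smul_smul, inv_mul_cancel₀ hε, one_smul]
  constructor
  · rw [← LinearMap.ker_eq_bot]
    rcases i1.2 _ hk with h | h
    · exact h
    · exact absurd (LinearMap.ker_eq_top.1 h) hF
  · rw [← LinearMap.range_eq_top]
    rcases i2.2 _ hr with h | h
    · exact absurd (LinearMap.range_eq_bot.1 h) hF
    · exact h

/-- The Schur lemma: a nonzero, not necessarily homogeneous, intertwiner between graded
irreducible representations gives an isomorphism. -/
lemma schur {U V : QModB n B} (r1 : RepFacts n B U.ρ) (r2 : RepFacts n B V.ρ)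
    (i1 : QAct.Irred n B U.ρ) (i2 : QAct.Irred n B V.ρ) (F : U.M →ₗ[ℂ] V.M) (hF : F ≠ 0)
    (hx : ∀ x v, F (U.ρ.act x v) = V.ρ.act x (F v)) : QModIso n U V := by
  let G : U.M →ₗ[ℂ] V.M := V.ρ.P ∘ₗ F ∘ₗ U.ρ.P
  have hGx : ∀ x v, G (U.ρ.act x v) = V.ρ.act x (G v) := by
    intro x v
    simp only [G, LinearMap.comp_apply]
    rw [r1.P_act, map_sub, hx, hx, map_sub, r2.Pev _ (isEven_evenPartL n B x),
      r2.Pod _ (isOdd_oddPartL n B x), act_split n B V.ρ x]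
    abel
  have hGP : ∀ v, G (U.ρ.P v) = V.ρ.P (F v) := by
    intro v
    simp only [G, LinearMap.comp_apply, r1.PP]
  have hFP : ∀ v, F (U.ρ.P v) = V.ρ.P (G v) := by
    intro v
    simp only [G, LinearMap.comp_apply, r2.PP]
  by_cases h : F + G = 0
  · have hne : F - G ≠ 0 := by
      intro h'
      apply hF
      have : (2 : ℂ) • F = 0 := by
        rw [two_smul]
        calc F + F = (F + G) + (F - G) := by abel
          _ = 0 := by rw [h, h', add_zero]
      exact (smul_eq_zero.1 this).resolve_left two_ne_zero
    have hb := bijective_of_homog n i1 i2 (F - G) hne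
      (fun x v => by simp [hx, hGx]) (-1) (by simp)
      (fun v => by simp [hFP, hGP])
    exact ⟨LinearEquiv.ofBijective _ hb, fun x v => by simp [hx, hGx]⟩
  · have hb := bijective_of_homog n i1 i2 (F + G) h
      (fun x v => by simp [hx, hGx]) 1 (by simp)
      (fun v => by simp [hFP, hGP, add_comm])
    exact ⟨LinearEquiv.ofBijective _ hb, fun x v => by simp [hx, hGx]⟩

/-- Contraction of the left factor. -/
def ctrL (l : M1 →ₗ[ℂ] ℂ) : M1 ⊗[ℂ] M2 →ₗ[ℂ] M2 :=
  (TensorProduct.lid ℂ M2).toLinearMap ∘ₗ TensorProduct.map l LinearMap.id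

/-- Contraction of the right factor. -/
def ctrR (l : M2 →ₗ[ℂ] ℂ) : M1 ⊗[ℂ] M2 →ₗ[ℂ] M1 :=
  (TensorProduct.rid ℂ M1).toLinearMap ∘ₗ TensorProduct.map LinearMap.id l

lemma ctrL_tmul (l : M1 →ₗ[ℂ] ℂ) (u : M1) (v : M2) : ctrL l (u ⊗ₜ[ℂ] v) = l u • v := by
  simp [ctrL]

lemma ctrR_tmul (l : M2 →ₗ[ℂ] ℂ) (u : M1) (v : M2) : ctrR l (u ⊗ₜ[ℂ] v) = l v • u := by
  simp [ctrR]

lemma ctrL_add (l l' : M1 →ₗ[ℂ] ℂ) (t : M1 ⊗[ℂ] M2) :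
    ctrL (l + l') t = ctrL l t + ctrL l' t := by
  simp [ctrL, TensorProduct.map_add_left]

lemma ctrR_add (l l' : M2 →ₗ[ℂ] ℂ) (t : M1 ⊗[ℂ] M2) :
    ctrR (l + l') t = ctrR l t + ctrR l' t := by
  simp [ctrR, TensorProduct.map_add_right]

lemma exists_ctr (t : M1 ⊗[ℂ] M2) (ht : t ≠ 0) :
    ∃ (l : M1 →ₗ[ℂ] ℂ) (l' : M2 →ₗ[ℂ] ℂ), l' (ctrL l t) ≠ 0 ∧ l (ctrR l' t) ≠ 0 := by
  by_contra hcon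
  apply ht
  let b1 := Module.Basis.ofVectorSpace ℂ M1
  let b2 := Module.Basis.ofVectorSpace ℂ M2
  apply (b1.tensorProduct b2).repr.injective
  rw [map_zero]
  ext ⟨i, j⟩
  have h1 : ∀ t : M1 ⊗[ℂ] M2, (b1.tensorProduct b2).repr t (i, j) =
      b2.coord j (ctrL (b1.coord i) t) := by
    intro t
    induction t with
    | zero => simp
    | add u v hu hv => simp only [map_add, Finsupp.add_apply, hu, hv]
    | tmul u v => simp [ctrL_tmul, mul_comm]
  have h2 : ∀ t : M1 ⊗[ℂ] M2, b2.coord j (ctrL (b1.coord i) t) =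
      b1.coord i (ctrR (b2.coord j) t) := by
    intro t
    induction t with
    | zero => simp
    | add u v hu hv => simp only [map_add, hu, hv]
    | tmul u v => simp [ctrL_tmul, ctrR_tmul, mul_comm]
  rw [h1]
  by_contra hne
  exact hcon ⟨_, _, hne, by rwa [← h2]⟩

/-- Decomposition of a functional with respect to an involution. -/
lemma homog_split (P : M →ₗ[ℂ] M) (hP : ∀ v, P (P v) = v) (l : M →ₗ[ℂ] ℂ) :
    ∃ l0 l1 : M →ₗ[ℂ] ℂ, l = l0 + l1 ∧ (∀ v, l0 (P v) = l0 v) ∧ ∀ v, l1 (P v) = - l1 v := by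
  refine ⟨(2⁻¹ : ℂ) • (l + l ∘ₗ P), (2⁻¹ : ℂ) • (l - l ∘ₗ P), ?_, ?_, ?_⟩
  · ext v
    simp
    ring
  · intro v
    simp [hP]
    ring
  · intro v
    simp [hP]
    ring

lemma exists_ctrL (P : M1 →ₗ[ℂ] M1) (hP : ∀ v, P (P v) = v) (t : M1 ⊗[ℂ] M2) (ht : t ≠ 0) :
    ∃ (l : M1 →ₗ[ℂ] ℂ) (ε : ℂ), (ε = 1 ∨ ε = -1) ∧ (∀ v, l (P v) = ε * l v) ∧
      ctrL l t ≠ 0 := by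
  obtain ⟨l, l', h, -⟩ := exists_ctr t ht
  obtain ⟨l0, l1, rfl, h0, h1⟩ := homog_split P hP l
  by_cases h2 : ctrL l0 t = 0
  · refine ⟨l1, -1, Or.inr rfl, fun v => by simp [h1], fun h3 => h ?_⟩
    rw [ctrL_add, h2, h3, add_zero, map_zero]
  · exact ⟨l0, 1, Or.inl rfl, fun v => by simp [h0], h2⟩

lemma exists_ctrR (P : M2 →ₗ[ℂ] M2) (hP : ∀ v, P (P v) = v) (t : M1 ⊗[ℂ] M2) (ht : t ≠ 0) :
    ∃ (l : M2 →ₗ[ℂ] ℂ) (ε : ℂ), (ε = 1 ∨ ε = -1) ∧ (∀ v, l (P v) = ε * l v) ∧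
      ctrR l t ≠ 0 := by
  obtain ⟨l, l', -, h⟩ := exists_ctr t ht
  obtain ⟨l0, l1, rfl, h0, h1⟩ := homog_split P hP l'
  by_cases h2 : ctrR l0 t = 0
  · refine ⟨l1, -1, Or.inr rfl, fun v => by simp [h1], fun h3 => h ?_⟩
    rw [ctrR_add, h2, h3, add_zero, map_zero]
  · exact ⟨l0, 1, Or.inl rfl, fun v => by simp [h0], h2⟩

/-- Elements `d ⊗ x` with `d` in all `ms i` act trivially on the tensor product. -/
lemma itTens_kill (d : B) : ∀ (k : ℕ) (Vs : Fin k → QModB n B),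
    (∀ i x, (Vs i).ρ.act (bs n d x) = 0) → ∀ x, (itTens n k Vs).ρ.act (bs n d x) = 0
  | 0, _, _, _ => rfl
  | k + 1, Vs, h, x => by
    have h1 := itTens_kill d k (fun i => Vs i.castSucc) (fun i => h _) x
    have h2 := h (Fin.last k)
    change TensorProduct.map ((itTens n k fun i => Vs i.castSucc).ρ.act (bs n d x)) LinearMap.id +
      TensorProduct.map LinearMap.id ((Vs (Fin.last k)).ρ.act (evenPartL n B (bs n d x))) +
      TensorProduct.map (itTens n k fun i => Vs i.castSucc).ρ.P
        ((Vs (Fin.last k)).ρ.act (oddPartL n B (bs n d x))) = 0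
    rw [h1, evenPartL_bs, oddPartL_bs, h2, h2]
    simp

lemma proj_last (d : B) (ρ1 : QAct n B M1) (ρ2 : QAct n B M2) (r1 : RepFacts n B ρ1)
    (r2 : RepFacts n B ρ2) (hk : ∀ x, ρ1.act (bs n d x) = 0)
    (hi : ∀ x, ρ2.act (bs n d x) = ρ2.act x) (t : M1 ⊗[ℂ] M2) (ht : t ≠ 0) :
    ∃ (f : M1 ⊗[ℂ] M2 →ₗ[ℂ] M2) (ε : ℂ), (ε = 1 ∨ ε = -1) ∧ f t ≠ 0 ∧
      (∀ x v, f (tActL n B ρ1 ρ2 (bs n d x) v) = ρ2.act x (f v)) ∧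
      ∀ v, f (TensorProduct.map ρ1.P ρ2.P v) = ε • ρ2.P (f v) := by
  obtain ⟨l, ε, hε, hl, hlt⟩ := exists_ctrL _ r1.PP t ht
  rcases hε with rfl | rfl
  · refine ⟨ctrL l, 1, Or.inl rfl, hlt, ?_, ?_⟩
    · intro x v
      induction v using TensorProduct.induction_on with
      | zero => simp
      | add u v hu hv => simp only [map_add, hu, hv]
      | tmul u v =>
        rw [tActL_tmul, hk, evenPartL_bs, oddPartL_bs, hi, hi]
        simp only [LinearMap.zero_apply, TensorProduct.zero_tmul, zero_add, map_add,
          ctrL_tmul, hl, one_mul, map_smul, act_split n B ρ2 x, smul_add]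
    · intro v
      induction v using TensorProduct.induction_on with
      | zero => simp
      | add u v hu hv => simp only [map_add, hu, hv, smul_add]
      | tmul u v => simp [ctrL_tmul, hl]
  · refine ⟨ρ2.P ∘ₗ ctrL l, -1, Or.inr rfl, ?_, ?_, ?_⟩
    · intro h
      apply hlt
      have := congrArg ρ2.P h
      simpa [r2.PP] using this
    · intro x v
      induction v using TensorProduct.induction_on with
      | zero => simp
      | add u v hu hv => simp only [map_add, hu, hv]
      | tmul u v =>
        rw [tActL_tmul, hk, evenPartL_bs, oddPartL_bs, hi, hi]
        simp only [LinearMap.zero_apply, TensorProduct.zero_tmul, zero_add, map_add,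
          LinearMap.comp_apply, r2.Pev _ (isEven_evenPartL n B x),
          r2.Pod _ (isOdd_oddPartL n B x),
          ctrL_tmul, hl, map_smul, act_split n B ρ2 x, smul_add]
        simp
    · intro v
      induction v using TensorProduct.induction_on with
      | zero => simp
      | add u v hu hv => simp only [map_add, hu, hv, smul_add]
      | tmul u v => simp [ctrL_tmul, hl]

lemma proj_cast (d : B) (ρ1 : QAct n B M1) (ρ2 : QAct n B M2)
    (r2 : RepFacts n B ρ2) (hk : ∀ x, ρ2.act (bs n d x) = 0) (t : M1 ⊗[ℂ] M2) (ht : t ≠ 0) :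
    ∃ (f : M1 ⊗[ℂ] M2 →ₗ[ℂ] M1) (ε : ℂ), (ε = 1 ∨ ε = -1) ∧ f t ≠ 0 ∧
      (∀ x v, f (tActL n B ρ1 ρ2 (bs n d x) v) = ρ1.act (bs n d x) (f v)) ∧
      ∀ v, f (TensorProduct.map ρ1.P ρ2.P v) = ε • ρ1.P (f v) := by
  obtain ⟨l, ε, hε, hl, hlt⟩ := exists_ctrR _ r2.PP t ht
  refine ⟨ctrR l, ε, hε, hlt, ?_, ?_⟩
  · intro x v
    induction v using TensorProduct.induction_on with
    | zero => simp
    | add u v hu hv => simp only [map_add, hu, hv]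
    | tmul u v =>
      rw [tActL_tmul, evenPartL_bs, oddPartL_bs, hk, hk]
      simp [ctrR_tmul]
  · intro v
    induction v using TensorProduct.induction_on with
    | zero => simp
    | add u v hu hv => simp only [map_add, hu, hv, smul_add]
    | tmul u v => simp [ctrR_tmul, hl, mul_smul]

/-- Projection of the tensor product to one of its factors. -/
lemma exists_proj (d : B) : ∀ (k : ℕ) (Vs : Fin k → QModB n B) (i : Fin k),
    (∀ j, RepFacts n B (Vs j).ρ) →
    (∀ j, j ≠ i → ∀ x, (Vs j).ρ.act (bs n d x) = 0) →
    (∀ x, (Vs i).ρ.act (bs n d x) = (Vs i).ρ.act x) →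
    ∀ t : (itTens n k Vs).M, t ≠ 0 → ∃ (f : (itTens n k Vs).M →ₗ[ℂ] (Vs i).M) (ε : ℂ),
      (ε = 1 ∨ ε = -1) ∧ f t ≠ 0 ∧
      (∀ x v, f ((itTens n k Vs).ρ.act (bs n d x) v) = (Vs i).ρ.act x (f v)) ∧
      ∀ v, f ((itTens n k Vs).ρ.P v) = ε • (Vs i).ρ.P (f v)
  | 0, _, i, _, _, _, _, _ => i.elim0
  | k + 1, Vs, i, hr, h0, hi, t, ht => by
    have hT := RepFacts.itTens n k (fun i => Vs i.castSucc) (fun i => hr _)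
    induction i using Fin.lastCases with
    | last =>
      have hk : ∀ x, (itTens n k fun i => Vs i.castSucc).ρ.act (bs n d x) = 0 :=
        itTens_kill n d k _ fun i => h0 _ (Fin.castSucc_lt_last i).ne
      exact proj_last n d (itTens n k fun i => Vs i.castSucc).ρ (Vs (Fin.last k)).ρ hT
        (hr _) hk hi t ht
    | cast i =>
      have hk := h0 (Fin.last k) (Fin.castSucc_lt_last i).ne'
      obtain ⟨g, ε, hε, hg0, hgx, hgP⟩ := proj_cast n d
        (itTens n k fun i => Vs i.castSucc).ρ (Vs (Fin.last k)).ρ (hr _) hk t ht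
      obtain ⟨f, ε', hε', hf0, hfx, hfP⟩ := exists_proj d k (fun i => Vs i.castSucc) i
        (fun j => hr _) (fun j hj => h0 _ fun h => hj (Fin.castSucc_injective k h)) hi _ hg0
      refine ⟨f ∘ₗ g, ε * ε', ?_, hf0, ?_, ?_⟩
      · rcases hε with rfl | rfl <;> rcases hε' with rfl | rfl <;> simp
      · intro x v
        exact (congrArg f (hgx x v)).trans (hfx x (g v))
      · intro v
        refine (congrArg f (hgP v)).trans ?_
        rw [map_smul, mul_smul]
        exact congrArg (ε • ·) (hfP (g v))

/-! ### Uniqueness -/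

lemma exists_sep (m : Ideal B) (hm : m.IsMaximal) (s : Finset (Ideal B))
    (hs : ∀ J ∈ s, J.IsMaximal ∧ J ≠ m) : ∃ d : B, (∀ J ∈ s, d ∈ J) ∧ 1 - d ∈ m := by
  have h1 : ¬ s.inf id ≤ m := by
    intro h
    obtain ⟨J, hJ, hle⟩ := (Ideal.IsPrime.inf_le' (s := s) (f := id) hm.isPrime).1 h
    exact (hs J hJ).2 ((hs J hJ).1.eq_of_le hm.ne_top hle)
  have h2 : m ⊔ s.inf id = ⊤ := by
    by_contra hne
    exact h1 (by rw [hm.eq_of_le hne le_sup_left]; exact le_sup_right)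
  have h3 : (1 : B) ∈ m ⊔ s.inf id := by rw [h2]; trivial
  obtain ⟨c, hc, d, hd, hcd⟩ := Submodule.mem_sup.1 h3
  refine ⟨d, fun J hJ => ?_, ?_⟩
  · exact (Finset.inf_le (f := id) hJ) hd
  · rw [← hcd, add_sub_cancel_right]
    exact hc

lemma suppAt_kill {m : Ideal B} {V : QModB n B} (h : SuppAt n m V) {d : B} (hd : d ∈ m)
    (x : ↥(qA n B)) : V.ρ.act (bs n d x) = 0 := h _ (bs_entries n m hd x)

lemma suppAt_one {m : Ideal B} {V : QModB n B} (h : SuppAt n m V) {d : B} (hd : 1 - d ∈ m)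
    (x : ↥(qA n B)) : V.ρ.act (bs n d x) = V.ρ.act x := by
  have := suppAt_kill n h hd x
  rw [bs_sub, bs_one, map_sub, sub_eq_zero] at this
  exact this.symm

lemma uniq_aux (k : ℕ) (ms : Fin k → Ideal B) (Vs : Fin k → QModB n B)
    (k' : ℕ) (ms' : Fin k' → Ideal B) (Vs' : Fin k' → QModB n B)
    (hg : GoodData n k ms Vs) (hg' : GoodData n k' ms' Vs')
    (W : Submodule ℂ (itTens n k Vs).M) (hW : QAct.Invt n B (itTens n k Vs).ρ W) (hW0 : W ≠ ⊥)
    (Φ : W →ₗ[ℂ] (itTens n k' Vs').M) (hΦ : Function.Injective Φ)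
    (hΦx : ∀ x (w : W), Φ ⟨(itTens n k Vs).ρ.act x w, hW.1 x w w.2⟩ =
      (itTens n k' Vs').ρ.act x (Φ w)) (i : Fin k) :
    (∃ i', ms' i' = ms i) ∧ ∀ i', ms' i' = ms i → QModIso n (Vs i) (Vs' i') := by
  classical
  have hr : ∀ j, RepFacts n B (Vs j).ρ := fun j => (repFacts_iff n B _).1 (hg.2.2 j).1
  have hr' : ∀ j, RepFacts n B (Vs' j).ρ := fun j => (repFacts_iff n B _).1 (hg'.2.2 j).1
  have hf : FiniteDimensional ℂ (itTens n k Vs).M := finDim_itTens n k Vs fun j => (hg.2.2 j).2.2.1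
  obtain ⟨d, hd, hd1⟩ := exists_sep (ms i) (hg.1 i)
    ((Finset.univ.image ms ∪ Finset.univ.image ms').erase (ms i)) (by
      intro J hJ
      simp only [Finset.mem_erase, Finset.mem_union, Finset.mem_image, Finset.mem_univ,
        true_and] at hJ
      rcases hJ with ⟨h1, ⟨j, rfl⟩ | ⟨j, rfl⟩⟩
      · exact ⟨hg.1 j, h1⟩
      · exact ⟨hg'.1 j, h1⟩)
  have hda : ∀ j, ms j ≠ ms i → d ∈ ms j := fun j hj => hd _ (by simp [hj])
  have hdb : ∀ j, ms' j ≠ ms i → d ∈ ms' j := fun j hj => hd _ (by simp [hj])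
  obtain ⟨S, hSW, hS⟩ := exists_irredSub n (QAct.tw n (itTens n k Vs).ρ d) W
    ⟨fun x m hm => hW.1 _ m hm, hW.2⟩ hW0
  obtain ⟨t, htS, ht0⟩ := S.ne_bot_iff.1 hS.1
  obtain ⟨f, ε, hε, hft, hfx, hfP⟩ := exists_proj n d k Vs i hr
    (fun j hj x => suppAt_kill n (hg.2.2 j).2.2.2.1 (hda j fun h => hj (hg.2.1 h)) x)
    (fun x => suppAt_one n (hg.2.2 i).2.2.2.1 hd1 x) t ht0
  have hε0 : ε ≠ 0 := by rcases hε with rfl | rfl <;> simp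
  have hb := bijective_of_homog n (sub_irred n hS) (hg.2.2 i).2.1 (f ∘ₗ S.subtype)
    (fun h => hft (LinearMap.congr_fun h ⟨t, htS⟩)) (fun x v => hfx x v) ε hε0 (fun v => hfP v)
  let E := LinearEquiv.ofBijective (f ∘ₗ S.subtype) hb
  have hE : ∀ s : S, E s = f s := fun s => rfl
  let G : S →ₗ[ℂ] (itTens n k' Vs').M := Φ ∘ₗ Submodule.inclusion hSW
  have hG : Function.Injective G := hΦ.comp (Submodule.inclusion_injective hSW)
  have hGx : ∀ x (s : S), G ((QAct.sub n B _ S hS.2.1).act x s) =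
      (itTens n k' Vs').ρ.act (bs n d x) (G s) :=
    fun x s => hΦx (bs n d x) (Submodule.inclusion hSW s)
  have hEx : ∀ x (s : S), E ((QAct.sub n B _ S hS.2.1).act x s) = (Vs i).ρ.act x (E s) :=
    fun x s => hfx x s
  constructor
  · by_contra hne
    push Not at hne
    have hk := itTens_kill n d k' Vs' fun j x =>
      suppAt_kill n (hg'.2.2 j).2.2.2.1 (hdb j (hne j)) x
    apply (hg.2.2 i).2.2.2.2
    intro x
    ext v
    obtain ⟨s, rfl⟩ := E.surjective v
    rw [← hEx]
    have h0 : (QAct.sub n B _ S hS.2.1).act x s = 0 := by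
      apply hG
      rw [hGx, hk, map_zero]
      rfl
    rw [h0, map_zero]
    rfl
  · intro i' hi'
    have hGt : G ⟨t, htS⟩ ≠ 0 := by
      intro h
      have := hG (h.trans (map_zero G).symm)
      exact ht0 (congrArg Subtype.val this)
    obtain ⟨f', ε', hε', hft', hfx', -⟩ := exists_proj n d k' Vs' i' hr'
      (fun j hj x => suppAt_kill n (hg'.2.2 j).2.2.2.1
        (hdb j fun h => hj (hg'.2.1 (h.trans hi'.symm))) x)
      (fun x => suppAt_one n (hg'.2.2 i').2.2.2.1 (by rw [hi']; exact hd1) x) _ hGt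
    refine schur n (hr i) (hr' i') (hg.2.2 i).2.1 (hg'.2.2 i').2.1
      (f' ∘ₗ G ∘ₗ E.symm.toLinearMap) ?_ ?_
    · intro h
      apply hft'
      have := LinearMap.congr_fun h (E ⟨t, htS⟩)
      simpa using this
    · intro x v
      obtain ⟨s, rfl⟩ := E.surjective v
      simp only [LinearMap.comp_apply, LinearEquiv.coe_coe, ← hEx, LinearEquiv.symm_apply_apply,
        hGx, hfx']

lemma match_map {k : ℕ} {ms : Fin k → Ideal B} {Vs : Fin k → QModB n B}
    {k' : ℕ} {ms' : Fin k' → Ideal B} {Vs' : Fin k' → QModB n B} {V V' : QModB n B}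
    (h : Matches n k ms Vs V) (h' : Matches n k' ms' Vs' V') (e : QModIso n V V') :
    ∃ (W : Submodule ℂ (itTens n k Vs).M) (hW : QAct.Invt n B (itTens n k Vs).ρ W),
      W ≠ ⊥ ∧ ∃ Φ : W →ₗ[ℂ] (itTens n k' Vs').M, Function.Injective Φ ∧
      ∀ x (w : W), Φ ⟨(itTens n k Vs).ρ.act x w, hW.1 x w w.2⟩ =
      (itTens n k' Vs').ρ.act x (Φ w) := by
  obtain ⟨W, hW, φ, hφ, rfl, hφx⟩ := h
  obtain ⟨W', hW', φ', hφ', -, hφx'⟩ := h'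
  obtain ⟨e, he⟩ := e
  refine ⟨_, hW.2.1, hW.1,
    φ' ∘ₗ e.toLinearMap ∘ₗ (LinearEquiv.ofInjective φ hφ).symm.toLinearMap, ?_, ?_⟩
  · exact hφ'.comp (e.injective.comp (LinearEquiv.injective _))
  · intro x w
    obtain ⟨v, rfl⟩ := (LinearEquiv.ofInjective φ hφ).surjective w
    have h1 : (⟨(itTens n k Vs).ρ.act x ((LinearEquiv.ofInjective φ hφ) v),
        hW.2.1.1 x _ ((LinearEquiv.ofInjective φ hφ) v).2⟩ : LinearMap.range φ) =
        LinearEquiv.ofInjective φ hφ (V.ρ.act x v) := Subtype.ext (hφx x v).symm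
    rw [h1]
    simp only [LinearMap.comp_apply, LinearEquiv.coe_coe, LinearEquiv.symm_apply_apply, he, hφx']

lemma QModIso.symm' {V V' : QModB n B} (e : QModIso n V V') : QModIso n V' V := by
  obtain ⟨e, he⟩ := e
  refine ⟨e.symm, fun x u => ?_⟩
  obtain ⟨v, rfl⟩ := e.surjective u
  rw [← he, e.symm_apply_apply, e.symm_apply_apply]

lemma part_three (k : ℕ) (ms : Fin k → Ideal B) (Vs : Fin k → QModB n B)
        (k' : ℕ) (ms' : Fin k' → Ideal B) (Vs' : Fin k' → QModB n B)
        (V V' : QModB n B)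
      (hg : GoodData n k ms Vs) (hg' : GoodData n k' ms' Vs')
      (hm : Matches n k ms Vs V) (hm' : Matches n k' ms' Vs' V')
      (e : QModIso n V V') :
      ∃ σ : Fin k ≃ Fin k', (∀ i, ms' (σ i) = ms i) ∧
        ∀ i, QModIso n (Vs i) (Vs' (σ i)) := by
  obtain ⟨W, hW, hW0, Φ, hΦ, hΦx⟩ := match_map n hm hm' e
  obtain ⟨W', hW', hW0', Φ', hΦ', hΦx'⟩ := match_map n hm' hm (QModIso.symm' n e)
  have h := uniq_aux n k ms Vs k' ms' Vs' hg hg' W hW hW0 Φ hΦ hΦx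
  have h' := uniq_aux n k' ms' Vs' k ms Vs hg' hg W' hW' hW0' Φ' hΦ' hΦx'
  choose σ hσ using fun i => (h i).1
  choose τ hτ using fun i => (h' i).1
  refine ⟨⟨σ, τ, fun i => hg.2.1 ?_, fun i => hg'.2.1 ?_⟩, hσ, fun i => (h i).2 _ (hσ i)⟩
  · rw [hτ, hσ]
  · rw [hσ, hτ]

/-! ### Elementary elements and the annihilator ideal -/

/-- The traceless part of a matrix. -/
def tlP : QMat n B →ₗ[ℂ] QMat n B where
  toFun X := X - (((n : ℂ) + 1)⁻¹ • X.trace) • (1 : QMat n B)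
  map_add' X Y := by
    rw [Matrix.trace_add, smul_add, add_smul]
    abel
  map_smul' c X := by
    rw [Matrix.trace_smul, smul_comm _ c, smul_assoc, RingHom.id_apply, smul_sub]

lemma tlP_apply (X : QMat n B) :
    tlP n X = X - (((n : ℂ) + 1)⁻¹ • X.trace) • (1 : QMat n B) := rfl

lemma inv_smul_card (c : B) : (((n : ℂ) + 1)⁻¹ • (((n + 1 : ℕ) : B) * c)) = c := by
  rw [← nsmul_eq_mul, ← Nat.cast_smul_eq_nsmul ℂ, smul_smul]
  rw [show (((n + 1 : ℕ) : ℂ)) = (n : ℂ) + 1 by push_cast; ring]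
  rw [inv_mul_cancel₀ (by
      exact_mod_cast Nat.cast_add_one_ne_zero (R := ℂ) n), one_smul]

lemma tlP_smul_one (c : B) : tlP n (c • (1 : QMat n B)) = 0 := by
  rw [tlP_apply, Matrix.trace_smul, Matrix.trace_one, smul_eq_mul, mul_comm, Fintype.card_fin,
    inv_smul_card, sub_self]

lemma tlP_of_trace {X : QMat n B} (h : X.trace = 0) : tlP n X = X := by
  rw [tlP_apply, h, smul_zero, zero_smul, sub_zero]

lemma trace_tlP (X : QMat n B) : (tlP n X).trace = 0 := by
  rw [tlP_apply, Matrix.trace_sub, Matrix.trace_smul, Matrix.trace_one, smul_eq_mul,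
    smul_mul_assoc, mul_comm, Fintype.card_fin, inv_smul_card, sub_self]

lemma tlP_bsmul (b : B) (X : QMat n B) : tlP n (b • X) = b • tlP n X := by
  rw [tlP_apply, tlP_apply, Matrix.trace_smul, smul_comm _ b, smul_assoc, smul_sub]

lemma tlP_comm (X Y : QMat n B) :
    tlP n X * tlP n Y - tlP n Y * tlP n X = X * Y - Y * X := by
  simp only [tlP_apply, sub_mul, mul_sub, Matrix.smul_mul, Matrix.mul_smul, one_mul, mul_one]
  rw [smul_comm]
  abel

/-- The even element with matrix (the traceless part of) `X`. -/
def evE : QMat n B →ₗ[ℂ] ↥(qA n B) where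
  toFun X := ⟨(tlP n X, 0), ⟨trace_tlP n X, by simp⟩⟩
  map_add' X Y := by ext <;> simp
  map_smul' c X := by ext <;> simp

/-- The odd element with matrix (the traceless part of) `X`. -/
def odE : QMat n B →ₗ[ℂ] ↥(qA n B) where
  toFun X := ⟨(0, tlP n X), ⟨by simp, trace_tlP n X⟩⟩
  map_add' X Y := by ext <;> simp
  map_smul' c X := by ext <;> simp

lemma isEven_evE (X : QMat n B) : IsEvenElt n B ↑(evE n X) := rfl
lemma isOdd_odE (X : QMat n B) : IsOddElt n B ↑(odE n X) := rfl

lemma evE_smul_one (c : B) : evE n (c • (1 : QMat n B)) = 0 := by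
  apply Subtype.ext
  exact Prod.ext (tlP_smul_one n c) rfl

lemma odE_smul_one (c : B) : odE n (c • (1 : QMat n B)) = 0 := by
  apply Subtype.ext
  exact Prod.ext rfl (tlP_smul_one n c)

lemma bs_evE (b : B) (X : QMat n B) : bs n b (evE n X) = evE n (b • X) := by
  apply Subtype.ext
  exact Prod.ext (tlP_bsmul n b X).symm (smul_zero _)

lemma bs_odE (b : B) (X : QMat n B) : bs n b (odE n X) = odE n (b • X) := by
  apply Subtype.ext
  exact Prod.ext (smul_zero _) (tlP_bsmul n b X).symm

lemma brs_evE_evE (X Y : QMat n B) : brs n (evE n X) (evE n Y) = evE n (X * Y - Y * X) := by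
  apply Subtype.ext
  have h : (X * Y - Y * X).trace = 0 := by
    rw [Matrix.trace_sub, Matrix.trace_mul_comm, sub_self]
  apply Prod.ext
  · simp [qbr, evE, tlP_comm, tlP_of_trace n h]
  · simp [qbr, evE]

lemma brs_evE_odE (X Y : QMat n B) : brs n (evE n X) (odE n Y) = odE n (X * Y - Y * X) := by
  apply Subtype.ext
  have h : (X * Y - Y * X).trace = 0 := by
    rw [Matrix.trace_sub, Matrix.trace_mul_comm, sub_self]
  apply Prod.ext
  · simp [qbr, evE, odE]
  · simp [qbr, evE, odE, tlP_comm, tlP_of_trace n h]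

lemma ev_od (x : ↥(qA n B)) :
    evE n (x : QPair n B).1 + odE n (x : QPair n B).2 = x := by
  apply Subtype.ext
  apply Prod.ext
  · simp [evE, odE, tlP_of_trace n x.2.1]
  · simp [evE, odE, tlP_of_trace n x.2.2]

lemma gen_lemma (hn : 2 ≤ n) (F : QMat n B →ₗ[ℂ] ↥(qA n B))
    (hF1 : ∀ c : B, F (c • (1 : QMat n B)) = 0) (N : Submodule ℂ ↥(qA n B)) (a b : B)
    (h : ∀ i j k l, F (Matrix.single i j a * Matrix.single k l b -
      Matrix.single k l b * Matrix.single i j a) ∈ N) (i j : Fin (n + 1)) :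
    F (Matrix.single i j (a * b)) ∈ N := by
  by_cases hij : i = j
  · subst hij
    have h1 : ∀ k, F (Matrix.single i i (a * b) - Matrix.single k k (a * b)) ∈ N := by
      intro k
      by_cases hk : i = k
      · subst hk; simp
      · have := h i k k i
        rwa [Matrix.single_mul_single_same, Matrix.single_mul_single_same, mul_comm b a] at this
    have h2 : ∑ k : Fin (n + 1), F (Matrix.single i i (a * b) - Matrix.single k k (a * b)) ∈ N :=
      Submodule.sum_mem _ fun k _ => h1 k
    have h3 : ∑ k : Fin (n + 1), Matrix.single k k (a * b) = (a * b) • (1 : QMat n B) := by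
      ext p q
      rw [Matrix.sum_apply, Matrix.smul_apply, Matrix.one_apply]
      by_cases hpq : p = q
      · subst hpq
        simp [Matrix.single_apply]
      · rw [if_neg hpq, smul_zero]
        refine Finset.sum_eq_zero fun k _ => ?_
        rw [Matrix.single_apply, if_neg]
        rintro ⟨rfl, rfl⟩
        exact hpq rfl
    rw [← map_sum, Finset.sum_sub_distrib, h3, map_sub, hF1, sub_zero, Finset.sum_const,
      Finset.card_univ, Fintype.card_fin, map_nsmul, ← Nat.cast_smul_eq_nsmul ℂ] at h2
    exact (Submodule.smul_mem_iff _ (by exact_mod_cast Nat.succ_ne_zero n)).1 h2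
  · have := h i i i j
    rwa [Matrix.single_mul_single_same, Matrix.single_mul_single_of_ne _ _ _ _ (Ne.symm hij),
      sub_zero] at this

/-- The ideal of all `b` such that `𝔮 ⊗ b` acts by zero. -/
def annI (ρ : QAct n B M) : Ideal B where
  carrier := {b | ∀ z, ρ.act (bs n b z) = 0}
  add_mem' := by
    intro a b ha hb z
    rw [bs_add, map_add, ha, hb, add_zero]
  zero_mem' := by
    intro z
    have : bs n (0 : B) z = 0 := by
      rw [← zero_smul ℂ (0 : B), bs_smul, zero_smul]
    rw [this, map_zero]
  smul_mem' := by
    intro c b hb z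
    rw [smul_eq_mul, mul_comm, bs_mul]
    exact hb _

lemma mem_annI {ρ : QAct n B M} {b : B} : b ∈ annI n ρ ↔ ∀ z, ρ.act (bs n b z) = 0 := Iff.rfl

lemma mat_mem (F : QMat n B →ₗ[ℂ] ↥(qA n B)) (N : Submodule ℂ ↥(qA n B)) (X : QMat n B)
    (h : ∀ i j, F (Matrix.single i j (X i j)) ∈ N) : F X ∈ N := by
  rw [Matrix.matrix_eq_sum_single X, map_sum]
  refine Submodule.sum_mem _ fun i _ => ?_
  rw [map_sum]
  exact Submodule.sum_mem _ fun j _ => h i j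

lemma single_eq (i j : Fin (n + 1)) (b : B) :
    (Matrix.single i j b : QMat n B) = b • Matrix.single i j 1 := by
  rw [Matrix.smul_single, smul_eq_mul, mul_one]

lemma annI_kill (ρ : QAct n B M) (x : ↥(qA n B)) (hx : EntriesIn n B (annI n ρ) ↑x) :
    ρ.act x = 0 := by
  rw [← LinearMap.mem_ker, ← ev_od n x]
  refine Submodule.add_mem _ (mat_mem n _ _ _ fun i j => ?_) (mat_mem n _ _ _ fun i j => ?_)
  · rw [single_eq, ← bs_evE, LinearMap.mem_ker]
    exact (hx i j).1 _
  · rw [single_eq, ← bs_odE, LinearMap.mem_ker]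
    exact (hx i j).2 _

lemma annI_iff (hn : 2 ≤ n) {ρ : QAct n B M} (hr : RepFacts n B ρ) (b : B) :
    b ∈ annI n ρ ↔ ∀ i j, ρ.act (evE n (Matrix.single i j b)) = 0 ∧
      ρ.act (odE n (Matrix.single i j b)) = 0 := by
  constructor
  · intro h i j
    rw [single_eq, ← bs_evE, ← bs_odE]
    exact ⟨h _, h _⟩
  · intro h z
    rw [← LinearMap.mem_ker, ← ev_od n z, map_add, bs_evE, bs_odE]
    refine Submodule.add_mem _ (mat_mem n _ _ _ fun i j => ?_) (mat_mem n _ _ _ fun i j => ?_)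
    · rw [Matrix.smul_apply, smul_eq_mul, mul_comm]
      refine gen_lemma n hn (evE n) (evE_smul_one n) _ _ _ (fun i j k l => ?_) i j
      rw [← brs_evE_evE, LinearMap.mem_ker]
      ext v
      rw [hr.bre _ _ (Or.inl (isEven_evE n _)), (h k l).1]
      simp
    · rw [Matrix.smul_apply, smul_eq_mul, mul_comm]
      refine gen_lemma n hn (odE n) (odE_smul_one n) _ _ _ (fun i j k l => ?_) i j
      rw [← brs_evE_odE, LinearMap.mem_ker]
      ext v
      rw [hr.bre _ _ (Or.inl (isEven_evE n _)), (h k l).2]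
      simp

lemma annI_finite (hn : 2 ≤ n) [FiniteDimensional ℂ M] {ρ : QAct n B M} (hr : RepFacts n B ρ) :
    FiniteDimensional ℂ (B ⧸ annI n ρ) := by
  let L : B →ₗ[ℂ] (Fin (n + 1) → Fin (n + 1) → Module.End ℂ M × Module.End ℂ M) :=
    LinearMap.pi fun i => LinearMap.pi fun j =>
      ((ρ.act ∘ₗ evE n ∘ₗ Matrix.singleLinearMap ℂ i j).prod
        (ρ.act ∘ₗ odE n ∘ₗ Matrix.singleLinearMap ℂ i j))
  have hL : LinearMap.ker L = (annI n ρ).restrictScalars ℂ := by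
    ext b
    rw [LinearMap.mem_ker, Submodule.restrictScalars_mem, annI_iff n hn hr]
    constructor
    · intro h i j
      have := congrFun (congrFun h i) j
      exact ⟨congrArg Prod.fst this, congrArg Prod.snd this⟩
    · intro h
      funext i j
      exact Prod.ext (h i j).1 (h i j).2
  have h1 : FiniteDimensional ℂ (B ⧸ LinearMap.ker L) :=
    Module.Finite.equiv L.quotKerEquivRange.symm
  rw [hL] at h1
  exact Module.Finite.equiv (Submodule.Quotient.restrictScalarsEquiv ℂ (annI n ρ))

/-! ### The annihilator ideal of an irreducible representation is radical -/

lemma nilp_comm [FiniteDimensional ℂ M] (X Y Z : Module.End ℂ M) (h : X = Y * Z - Z * Y)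
    (hc : X * Y = Y * X) : IsNilpotent X := by
  have htr : ∀ R : Module.End ℂ M, R * Y = Y * R → LinearMap.trace ℂ M (X * R) = 0 := by
    intro R hR
    have : X * R = Y * (Z * R) - (Z * R) * Y := by
      rw [h, sub_mul, mul_assoc, mul_assoc, mul_assoc, hR]
    rw [this, map_sub, LinearMap.trace_mul_comm, sub_self]
  have hinteg : IsIntegral ℂ X := Algebra.IsIntegral.isIntegral X
  obtain ⟨q, hq, hnd⟩ := Polynomial.exists_eq_pow_rootMultiplicity_mul_and_not_dvd
    (minpoly ℂ X) (minpoly.ne_zero hinteg) 0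
  set r := (minpoly ℂ X).rootMultiplicity 0
  rw [Polynomial.C_0, sub_zero] at hq hnd
  have hcop : IsCoprime ((Polynomial.X : Polynomial ℂ) ^ (r + 1)) q :=
    ((Polynomial.irreducible_X).coprime_iff_not_dvd.2 hnd).pow_left
  obtain ⟨u, v, huv⟩ := hcop
  have h0 : Polynomial.aeval X (Polynomial.X ^ r * q) = 0 := by
    rw [← hq]; exact minpoly.aeval ℂ X
  let e := Polynomial.aeval X (u * Polynomial.X ^ (r + 1))
  have he1 : e + Polynomial.aeval X (v * q) = 1 := by
    rw [← map_add, huv, map_one]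
  have he2 : e * Polynomial.aeval X (v * q) = 0 := by
    rw [← map_mul, show u * Polynomial.X ^ (r + 1) * (v * q) =
      (u * Polynomial.X * v) * (Polynomial.X ^ r * q) by ring, map_mul, h0, mul_zero]
  have hidem : IsIdempotentElem e := by
    have := congrArg (e * ·) he1
    simp only [mul_add, he2, add_zero, mul_one] at this
    exact this
  have htr0 : LinearMap.trace ℂ M e = 0 := by
    have : e = X * Polynomial.aeval X (u * Polynomial.X ^ r) := by
      have h1 : X = Polynomial.aeval X (Polynomial.X : Polynomial ℂ) := by simp
      conv_rhs => rw [h1]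
      rw [Polynomial.aeval_X, ← Polynomial.aeval_X (R := ℂ) X]
      simp only [Polynomial.aeval_X, e]
      rw [show u * Polynomial.X ^ (r + 1) = Polynomial.X * (u * Polynomial.X ^ r) by ring,
        map_mul, Polynomial.aeval_X]
    rw [this]
    apply htr
    have hcm : Commute Y X := hc.symm
    have : Polynomial.aeval X (u * Polynomial.X ^ r) ∈ Algebra.adjoin ℂ {X} :=
      Polynomial.aeval_mem_adjoin_singleton ℂ X
    exact ((Algebra.commute_of_mem_adjoin_singleton_of_commute this hcm).eq).symm
  have he0 : e = 0 := LinearMap.IsIdempotentElem.eq_zero_of_trace_eq_zero hidem htr0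
  refine ⟨r, ?_⟩
  have h3 : Polynomial.aeval X (v * q) = 1 := by rw [← he1, he0, zero_add]
  calc X ^ r = X ^ r * Polynomial.aeval X (v * q) := by rw [h3, mul_one]
    _ = Polynomial.aeval X (v * (Polynomial.X ^ r * q)) := by
        rw [show v * (Polynomial.X ^ r * q) = Polynomial.X ^ r * (v * q) by ring]
        rw [map_mul (Polynomial.aeval X) (Polynomial.X ^ r), map_pow, Polynomial.aeval_X]
    _ = 0 := by rw [map_mul, h0, mul_zero]

lemma nilp_ker (T : Module.End ℂ M) (hT : IsNilpotent T) (U : Submodule ℂ M) (hU0 : U ≠ ⊥)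
    (hU : ∀ u ∈ U, T u ∈ U) : LinearMap.ker T ⊓ U ≠ ⊥ := by
  obtain ⟨k, hk⟩ := hT
  obtain ⟨u, hu, hu0⟩ := U.ne_bot_iff.1 hU0
  intro hbot
  have : ∀ j, (T ^ j) u ≠ 0 ∧ (T ^ j) u ∈ U := by
    intro j
    induction j with
    | zero => exact ⟨hu0, hu⟩
    | succ j ih =>
      rw [pow_succ']
      refine ⟨fun h0 => ih.1 ?_, hU _ ih.2⟩
      have : (T ^ j) u ∈ LinearMap.ker T ⊓ U := ⟨h0, ih.2⟩
      rwa [hbot, Submodule.mem_bot] at this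
  apply (this k).1
  rw [hk]
  rfl

lemma ev_span (hn : 2 ≤ n) (N : Submodule ℂ ↥(qA n B))
    (h : ∀ x y : ↥(qA n B), IsEvenElt n B ↑x → IsEvenElt n B ↑y → brs n x y ∈ N)
    (X : QMat n B) : evE n X ∈ N := by
  refine mat_mem n _ _ _ fun i j => ?_
  rw [← mul_one (X i j)]
  refine gen_lemma n hn (evE n) (evE_smul_one n) _ _ _ (fun i j k l => ?_) i j
  rw [← brs_evE_evE]
  exact h _ _ (isEven_evE n _) (isEven_evE n _)

lemma annI_sq (hn : 2 ≤ n) [FiniteDimensional ℂ M] {ρ : QAct n B M} (hr : RepFacts n B ρ)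
    (hi : QAct.Irred n B ρ) (a : B) (ha : a * a ∈ annI n ρ) : a ∈ annI n ρ := by
  have hbr : ∀ x y v, ρ.act (brs n (bs n a x) (bs n a y)) v = 0 := by
    intro x y v
    rw [bs_brs, ha]
    rfl
  -- a minimal stable subspace
  obtain ⟨hnt, hirr⟩ := hi
  obtain ⟨U, ⟨hU0, hU⟩, hmin⟩ := (wellFounded_lt (α := Submodule ℂ M)).has_min
    {U | U ≠ ⊥ ∧ ∀ z, ∀ u ∈ U, ρ.act (bs n a z) u ∈ U}
    ⟨⊤, top_ne_bot, fun _ _ _ => Submodule.mem_top⟩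
  have key : ∀ z : ↥(qA n B), (IsEvenElt n B ↑z ∨ IsOddElt n B ↑z) →
      IsNilpotent (R := Module.End ℂ M) (ρ.act (bs n a z)) → ∀ u ∈ U, ρ.act (bs n a z) u = 0 := by
    intro z hz hnil u hu
    have h1 := nilp_ker _ hnil U hU0 (hU z)
    have h2 : ∀ w, ∀ u ∈ LinearMap.ker (ρ.act (bs n a z)) ⊓ U,
        ρ.act (bs n a w) u ∈ LinearMap.ker (ρ.act (bs n a z)) ⊓ U := by
      rintro w u ⟨hu1, hu2⟩
      refine ⟨?_, hU w u hu2⟩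
      change ρ.act (bs n a z) u = 0 at hu1
      change ρ.act (bs n a z) (ρ.act (bs n a w) u) = 0
      rcases hz with hz | hz
      · have := hr.bre (bs n a z) (bs n a w) (Or.inl (bs_even n a hz)) u
        rw [hbr, hu1, map_zero, sub_zero] at this
        exact this.symm
      · rw [act_split n B ρ (bs n a w), map_add, evenPartL_bs, oddPartL_bs]
        have e1 := hr.bre (bs n a z) (bs n a (evenPartL n B w))
          (Or.inr (bs_even n a (isEven_evenPartL n B w))) u
        have e2 := hr.bro (bs n a z) (bs n a (oddPartL n B w)) (bs_odd n a hz)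
          (bs_odd n a (isOdd_oddPartL n B w)) u
        rw [hbr, hu1, map_zero, sub_zero] at e1
        rw [hbr, hu1, map_zero, add_zero] at e2
        rw [← e1, ← e2, add_zero]
    have h3 : LinearMap.ker (ρ.act (bs n a z)) ⊓ U = U := by
      by_contra hne
      exact hmin _ ⟨h1, h2⟩ (lt_of_le_of_ne inf_le_right hne)
    rw [← h3] at hu
    exact hu.1
  let N : Submodule ℂ ↥(qA n B) :=
    { carrier := {z | ∀ u ∈ U, ρ.act (bs n a z) u = 0}
      add_mem' := by
        intro x y hx hy u hu
        rw [map_add, map_add, LinearMap.add_apply, hx u hu, hy u hu, add_zero]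
      zero_mem' := by
        intro u hu
        simp
      smul_mem' := by
        intro c x hx u hu
        rw [map_smul, map_smul, LinearMap.smul_apply, hx u hu, smul_zero] }
  have hN : ∀ z, z ∈ N := by
    intro z
    rw [← ev_od n z]
    refine N.add_mem (ev_span n hn N ?_ _) ?_
    · intro x y hx hy
      refine key _ (Or.inl (brs_even_even n hx hy)) ?_
      refine nilp_comm _ (ρ.act (bs n a x)) (ρ.act y) ?_ ?_
      · have h1 : bs n a (brs n x y) = brs n (bs n a x) y := by
          conv_rhs => rw [← bs_one n y, bs_brs, mul_one]
        rw [h1]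
        ext v
        exact hr.bre _ _ (Or.inr hy) v
      · ext v
        have := hr.bre (bs n a (brs n x y)) (bs n a x) (Or.inr (bs_even n a hx)) v
        rw [hbr] at this
        exact (sub_eq_zero.1 this.symm)
    · refine key _ (Or.inr (isOdd_odE n _)) ⟨2, ?_⟩
      ext v
      have := hr.bro (bs n a (odE n (z : QPair n B).2)) (bs n a (odE n (z : QPair n B).2))
        (bs_odd n a (isOdd_odE n _)) (bs_odd n a (isOdd_odE n _)) v
      rw [hbr, ← two_smul ℂ] at this
      rw [pow_two]
      exact (smul_eq_zero.1 this.symm).resolve_left two_ne_zero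
  let K : Submodule ℂ M := ⨅ z, LinearMap.ker (ρ.act (bs n a z))
  have hK : ∀ v, v ∈ K ↔ ∀ z, ρ.act (bs n a z) v = 0 := by
    intro v
    simp [K, Submodule.mem_iInf]
  have hKinv : QAct.Invt n B ρ K := by
    have hstep : ∀ (y z : ↥(qA n B)) v, (IsEvenElt n B ↑y ∨ IsOddElt n B ↑y) →
        (IsEvenElt n B ↑z ∨ IsOddElt n B ↑z) → v ∈ K → ρ.act (bs n a z) (ρ.act y v) = 0 := by
      intro y z v hy hz hv
      rw [hK] at hv
      have h1 : brs n (bs n a z) y = bs n a (brs n z y) := by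
        conv_lhs => rw [← bs_one n y, bs_brs, mul_one]
      by_cases he : IsEvenElt n B ↑(bs n a z) ∨ IsEvenElt n B ↑y
      · have := hr.bre (bs n a z) y he v
        rw [hv z, map_zero, sub_zero] at this
        rw [← this]
        change ρ.act (brs n (bs n a z) y) v = 0
        rw [h1, hv]
      · push Not at he
        have := hr.bro (bs n a z) y (bs_odd n a (hz.resolve_left fun h => he.1 (bs_even n a h)))
          (hy.resolve_left he.2) v
        rw [hv z, map_zero, add_zero] at this
        rw [← this]
        change ρ.act (brs n (bs n a z) y) v = 0
        rw [h1, hv]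
    constructor
    · intro y v hv
      rw [hK]
      intro z
      rw [act_split, act_split n B ρ y, evenPartL_bs, oddPartL_bs, map_add, map_add]
      rw [hstep _ _ v (Or.inl (isEven_evenPartL n B y)) (Or.inl (isEven_evenPartL n B z)) hv,
        hstep _ _ v (Or.inr (isOdd_oddPartL n B y)) (Or.inl (isEven_evenPartL n B z)) hv,
        hstep _ _ v (Or.inl (isEven_evenPartL n B y)) (Or.inr (isOdd_oddPartL n B z)) hv,
        hstep _ _ v (Or.inr (isOdd_oddPartL n B y)) (Or.inr (isOdd_oddPartL n B z)) hv]
      simp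
    · intro v hv
      rw [hK] at *
      intro z
      rw [act_split, evenPartL_bs, oddPartL_bs]
      have e1 := hr.Pev _ (bs_even n a (isEven_evenPartL n B z)) v
      have e2 := hr.Pod _ (bs_odd n a (isOdd_oddPartL n B z)) v
      rw [hv, map_zero] at e1 e2
      rw [← e1, neg_eq_zero.1 e2.symm, add_zero]
  have hKtop : K = ⊤ := by
    refine (hirr K hKinv).resolve_left fun hb => hU0 ?_
    rw [← le_bot_iff, ← hb]
    intro u hu
    rw [hK]
    exact fun z => hN z u hu
  intro z
  ext v
  have : v ∈ K := by rw [hKtop]; trivial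
  exact (hK v).1 this z

lemma annI_inf (hn : 2 ≤ n) [Algebra.FiniteType ℂ B] [FiniteDimensional ℂ M] {ρ : QAct n B M}
    (hr : RepFacts n B ρ) (hi : QAct.Irred n B ρ) :
    ∃ s : Finset (Ideal B), (∀ m ∈ s, m.IsMaximal) ∧ s.inf id ≤ annI n ρ := by
  have hnoeth : IsNoetherianRing B := Algebra.FiniteType.isNoetherianRing ℂ B
  have hfin := annI_finite n hn hr
  have hrad : (annI n ρ).IsRadical := by
    rw [Ideal.isRadical_iff_quotient_reduced]
    refine (isReduced_iff_pow_one_lt 2 one_lt_two).2 fun x hx => ?_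
    obtain ⟨a, rfl⟩ := Ideal.Quotient.mk_surjective x
    rw [← map_pow, Ideal.Quotient.eq_zero_iff_mem, pow_two] at hx
    rw [Ideal.Quotient.eq_zero_iff_mem]
    exact annI_sq n hn hr hi a hx
  have hf := Ideal.finite_minimalPrimes_of_isNoetherianRing B (annI n ρ)
  refine ⟨hf.toFinset, fun p hp => ?_, ?_⟩
  · rw [Set.Finite.mem_toFinset] at hp
    have hpp : p.IsPrime := hp.1.1
    have hle : annI n ρ ≤ p := hp.1.2
    have : Module.Finite ℂ (B ⧸ p) := Module.Finite.of_surjective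
      (Ideal.Quotient.factorₐ ℂ hle).toLinearMap (Ideal.Quotient.factor_surjective hle)
    have : IsArtinianRing (B ⧸ p) := IsArtinianRing.of_finite ℂ (B ⧸ p)
    exact Ideal.Quotient.maximal_of_isField _ (IsArtinianRing.isField_of_isDomain _)
  · have h1 : sInf (annI n ρ).minimalPrimes = annI n ρ := by
      rw [Ideal.sInf_minimalPrimes, hrad.radical]
    conv_rhs => rw [← h1]
    refine le_sInf fun p hp => ?_
    exact Finset.inf_le (f := id) (hf.mem_toFinset.2 hp)

/-! ### Splitting off a tensor factor -/

/-- The quotient action. -/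
def QAct.quot (ρ : QAct n B M) (K : Submodule ℂ M) (hK : QAct.Invt n B ρ K) :
    QAct n B (M ⧸ K) where
  act :=
    { toFun := fun x => K.mapQ K (ρ.act x) (fun m hm => hK.1 x m hm)
      map_add' := by
        intro x y
        apply Submodule.linearMap_qext
        ext v
        simp
      map_smul' := by
        intro c y
        apply Submodule.linearMap_qext
        ext v
        simp }
  P := K.mapQ K ρ.P hK.2

lemma quot_act (ρ : QAct n B M) (K : Submodule ℂ M) (hK : QAct.Invt n B ρ K)
    (x : ↥(qA n B)) (v : M) :
    (QAct.quot n ρ K hK).act x (K.mkQ v) = K.mkQ (ρ.act x v) := rfl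

lemma quot_P (ρ : QAct n B M) (K : Submodule ℂ M) (hK : QAct.Invt n B ρ K) (v : M) :
    (QAct.quot n ρ K hK).P (K.mkQ v) = K.mkQ (ρ.P v) := rfl

lemma RepFacts.quot {ρ : QAct n B M} (h : RepFacts n B ρ) (K : Submodule ℂ M)
    (hK : QAct.Invt n B ρ K) : RepFacts n B (QAct.quot n ρ K hK) where
  PP v := by
    obtain ⟨v, rfl⟩ := K.mkQ_surjective v
    rw [quot_P, quot_P, h.PP]
  Pev x hx v := by
    obtain ⟨v, rfl⟩ := K.mkQ_surjective v
    simp only [quot_P, quot_act, h.Pev x hx]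
  Pod x hx v := by
    obtain ⟨v, rfl⟩ := K.mkQ_surjective v
    simp only [quot_P, quot_act, h.Pod x hx, map_neg]
  bre x y hxy v := by
    obtain ⟨v, rfl⟩ := K.mkQ_surjective v
    simp only [quot_act, h.bre x y hxy, map_sub]
  bro x y hx hy v := by
    obtain ⟨v, rfl⟩ := K.mkQ_surjective v
    simp only [quot_act, h.bro x y hx hy, map_add]

lemma quot_irred {ρ : QAct n B M} (K : Submodule ℂ M) (hK : QAct.Invt n B ρ K) (hne : K ≠ ⊤)
    (hmax : ∀ K', K ≤ K' → QAct.Invt n B ρ K' → K' = K ∨ K' = ⊤) :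
    QAct.Irred n B (QAct.quot n ρ K hK) := by
  refine ⟨Submodule.Quotient.nontrivial_iff.2 hne, fun N hN => ?_⟩
  have hinv : QAct.Invt n B ρ (N.comap K.mkQ) :=
    ⟨fun x m hm => hN.1 x _ hm, fun m hm => hN.2 _ hm⟩
  have hle : K ≤ N.comap K.mkQ := by
    intro v hv
    rw [Submodule.mem_comap, Submodule.mkQ_apply, (Submodule.Quotient.mk_eq_zero K).2 hv]
    exact N.zero_mem
  rcases hmax _ hle hinv with h | h
  · left
    rw [← Submodule.map_comap_eq_of_surjective K.mkQ_surjective N, h]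
    exact Submodule.mkQ_map_self K
  · right
    rw [← Submodule.map_comap_eq_of_surjective K.mkQ_surjective N, h, Submodule.map_top,
      Submodule.range_mkQ]

/-- The dual (pseudo)action. -/
def QAct.dual (κ : QAct n B M) : QAct n B (Module.Dual ℂ M) where
  act := Module.Dual.transpose ∘ₗ κ.act
  P := Module.Dual.transpose κ.P

lemma dual_act (κ : QAct n B M) (x : ↥(qA n B)) (ξ : Module.Dual ℂ M) (s : M) :
    (QAct.dual n κ).act x ξ s = ξ (κ.act x s) := rfl

lemma dual_P (κ : QAct n B M) (ξ : Module.Dual ℂ M) (s : M) :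
    (QAct.dual n κ).P ξ s = ξ (κ.P s) := rfl

lemma dual_irred [FiniteDimensional ℂ M] {κ : QAct n B M} (h : QAct.Irred n B κ) :
    QAct.Irred n B (QAct.dual n κ) := by
  have := h.1
  refine ⟨inferInstance, fun N hN => ?_⟩
  have hinv : QAct.Invt n B κ N.dualCoannihilator := by
    constructor
    · intro x m hm
      rw [Submodule.mem_dualCoannihilator] at *
      intro ξ hξ
      exact hm _ (hN.1 x ξ hξ)
    · intro m hm
      rw [Submodule.mem_dualCoannihilator] at *
      intro ξ hξ
      exact hm _ (hN.2 ξ hξ)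
  have hN' := Subspace.dualCoannihilator_dualAnnihilator_eq (W := N)
  rcases h.2 _ hinv with h | h
  · right
    rw [← hN', h, Submodule.dualAnnihilator_bot]
  · left
    rw [← hN', h, Submodule.dualAnnihilator_top]

/-- The right (pseudo)action on a space of homomorphisms. -/
def QAct.homR (ρ1 : QAct n B M1) (ρ2 : QAct n B M2) : QAct n B (M1 →ₗ[ℂ] M2) where
  act := (LinearMap.llcomp ℂ M1 M1 M2).flip ∘ₗ ρ1.act
  P := (LinearMap.llcomp ℂ M1 M2 M2 ρ2.P) ∘ₗ LinearMap.lcomp ℂ M2 ρ1.P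

lemma homR_act (ρ1 : QAct n B M1) (ρ2 : QAct n B M2) (x : ↥(qA n B)) (f : M1 →ₗ[ℂ] M2) (v : M1) :
    (QAct.homR n ρ1 ρ2).act x f v = f (ρ1.act x v) := rfl

lemma homR_P (ρ1 : QAct n B M1) (ρ2 : QAct n B M2) (f : M1 →ₗ[ℂ] M2) (v : M1) :
    (QAct.homR n ρ1 ρ2).P f v = ρ2.P (f (ρ1.P v)) := rfl

lemma dualTens_act [FiniteDimensional ℂ M1] (κ : QAct n B M1) (σ : QAct n B M2) (x : ↥(qA n B))
    (t : Module.Dual ℂ M1 ⊗[ℂ] M2) (s : M1) :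
    dualTensorHom ℂ M1 M2 (tActL n B (QAct.dual n κ) σ x t) s =
      dualTensorHom ℂ M1 M2 t (κ.act x s) +
      σ.act (evenPartL n B x) (dualTensorHom ℂ M1 M2 t s) +
      σ.act (oddPartL n B x) (dualTensorHom ℂ M1 M2 t (κ.P s)) := by
  induction t with
  | zero => simp
  | add u v hu hv =>
    simp only [map_add, LinearMap.add_apply, hu, hv]
    abel
  | tmul ξ y =>
    simp only [tActL_tmul, map_add, LinearMap.add_apply, dualTensorHom_apply, dual_act, dual_P,
      map_smul]

lemma dualTens_P [FiniteDimensional ℂ M1] (κ : QAct n B M1) (σ : QAct n B M2)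
    (t : Module.Dual ℂ M1 ⊗[ℂ] M2) (s : M1) :
    dualTensorHom ℂ M1 M2 (TensorProduct.map (QAct.dual n κ).P σ.P t) s =
      σ.P (dualTensorHom ℂ M1 M2 t (κ.P s)) := by
  induction t with
  | zero => simp
  | add u v hu hv => simp only [map_add, LinearMap.add_apply, hu, hv]
  | tmul ξ y =>
    simp only [TensorProduct.map_tmul, dualTensorHom_apply, dual_P, map_smul]

lemma phi_exists [FiniteDimensional ℂ M] (κ : QAct n B M) (σ : QAct n B M2) (ρ : QAct n B M1)
    (ι : M →ₗ[ℂ] M1 →ₗ[ℂ] M2)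
    (h1 : ∀ x s v, ι s (ρ.act x v) = ι (κ.act x s) v + σ.act (evenPartL n B x) (ι s v) +
      σ.act (oddPartL n B x) (ι (κ.P s) v))
    (h2 : ∀ s v, ι s (ρ.P v) = σ.P (ι (κ.P s) v)) :
    ∃ φ : M1 →ₗ[ℂ] Module.Dual ℂ M ⊗[ℂ] M2,
      (∀ x v, φ (ρ.act x v) = tActL n B (QAct.dual n κ) σ x (φ v)) ∧
      (∀ v, φ (ρ.P v) = TensorProduct.map (QAct.dual n κ).P σ.P (φ v)) ∧
      ∀ v, φ v = 0 → ∀ s, ι s v = 0 := by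
  let D := dualTensorHomEquiv ℂ M M2
  have hD : ∀ t, D t = dualTensorHom ℂ M M2 t := fun t => rfl
  let φ : M1 →ₗ[ℂ] Module.Dual ℂ M ⊗[ℂ] M2 := D.symm.toLinearMap ∘ₗ ι.flip
  have hφ : ∀ v s, dualTensorHom ℂ M M2 (φ v) s = ι s v := by
    intro v s
    rw [← hD]
    simp [φ]
  have hext : ∀ t t' : Module.Dual ℂ M ⊗[ℂ] M2, (∀ s, dualTensorHom ℂ M M2 t s =
      dualTensorHom ℂ M M2 t' s) → t = t' := by
    intro t t' h
    apply D.injective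
    rw [hD, hD]
    exact LinearMap.ext h
  refine ⟨φ, ?_, ?_, ?_⟩
  · intro x v
    apply hext
    intro s
    rw [dualTens_act, hφ, hφ, hφ, hφ, h1]
  · intro v
    apply hext
    intro s
    rw [dualTens_P, hφ, hφ, h2]
  · intro v hv s
    rw [← hφ, hv]
    simp

set_option maxHeartbeats 1000000 in
lemma split_lemma {M : Type} [AddCommGroup M] [Module ℂ M] [FiniteDimensional ℂ M]
    (ρ ρ' ρ'' : QAct n B M) (r' : RepFacts n B ρ') (r'' : RepFacts n B ρ'')
    (hP' : ρ'.P = ρ.P) (hP'' : ρ''.P = ρ.P)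
    (hsum : ∀ x v, ρ.act x v = ρ'.act x v + ρ''.act x v)
    (hc1 : ∀ x y : ↥(qA n B), (IsEvenElt n B ↑x ∨ IsEvenElt n B ↑y) → ∀ v,
      ρ'.act x (ρ''.act y v) = ρ''.act y (ρ'.act x v))
    (hc2 : ∀ x y : ↥(qA n B), IsOddElt n B ↑x → IsOddElt n B ↑y → ∀ v,
      ρ'.act x (ρ''.act y v) = -ρ''.act y (ρ'.act x v))
    (hirr : QAct.Irred n B ρ) :
    ∃ X Y : QModB n B, RepFacts n B X.ρ ∧ RepFacts n B Y.ρ ∧ QAct.Irred n B X.ρ ∧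
      QAct.Irred n B Y.ρ ∧ FiniteDimensional ℂ X.M ∧ FiniteDimensional ℂ Y.M ∧
      (∀ x, ρ'.act x = 0 → X.ρ.act x = 0) ∧ (∀ x, ρ''.act x = 0 → Y.ρ.act x = 0) ∧
      (TrivialActs n Y → ∀ x, ρ''.act x = 0) ∧
      ∃ φ : M →ₗ[ℂ] X.M ⊗[ℂ] Y.M, Function.Injective φ ∧
        (∀ x v, φ (ρ.act x v) = tActL n B X.ρ Y.ρ x (φ v)) ∧
        ∀ v, φ (ρ.P v) = TensorProduct.map X.ρ.P Y.ρ.P (φ v) := by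
  have hnt := hirr.1
  -- the quotient `Y`
  obtain ⟨K, ⟨hKne, hK⟩, hKmax⟩ := (wellFounded_gt (α := Submodule ℂ M)).has_min
    {K | K ≠ ⊤ ∧ QAct.Invt n B ρ'' K} ⟨⊥, bot_ne_top, by
      constructor
      · rintro x m hm
        rw [Submodule.mem_bot] at *
        rw [hm, map_zero]
      · rintro m hm
        rw [Submodule.mem_bot] at *
        rw [hm, map_zero]⟩
  have hKmax' : ∀ K', K ≤ K' → QAct.Invt n B ρ'' K' → K' = K ∨ K' = ⊤ := by
    intro K' hle hinv
    by_contra hcon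
    push Not at hcon
    exact hKmax K' ⟨hcon.2, hinv⟩ (lt_of_le_of_ne hle (Ne.symm hcon.1))
  set σ := QAct.quot n ρ'' K hK with hσ
  have rσ : RepFacts n B σ := r''.quot n K hK
  have iσ : QAct.Irred n B σ := quot_irred n K hK hKne hKmax'
  set κ := QAct.homR n ρ' σ with hκ
  let U : Submodule ℂ (M →ₗ[ℂ] M ⧸ K) :=
    { carrier := {f | (∀ x : ↥(qA n B), IsEvenElt n B ↑x → ∀ v, f (ρ''.act x v) = σ.act x (f v)) ∧
        ∀ x : ↥(qA n B), IsOddElt n B ↑x → ∀ v, f (ρ''.act x v) = σ.act x (σ.P (f (ρ.P v)))}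
      add_mem' := by
        intro f g hf hg
        exact ⟨fun x hx v => by simp [hf.1 x hx, hg.1 x hx],
          fun x hx v => by simp [hf.2 x hx, hg.2 x hx]⟩
      zero_mem' := ⟨fun x hx v => by simp, fun x hx v => by simp⟩
      smul_mem' := by
        intro c f hf
        exact ⟨fun x hx v => by simp [hf.1 x hx], fun x hx v => by simp [hf.2 x hx]⟩ }
  have hUm : ∀ f, f ∈ U ↔ (∀ x : ↥(qA n B), IsEvenElt n B ↑x → ∀ v, f (ρ''.act x v) = σ.act x (f v)) ∧
        ∀ x : ↥(qA n B), IsOddElt n B ↑x → ∀ v, f (ρ''.act x v) = σ.act x (σ.P (f (ρ.P v))) :=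
    fun f => Iff.rfl
  have hPP : ∀ v, ρ.P (ρ.P v) = v := by rw [← hP']; exact r'.PP
  have hmk : K.mkQ ∈ U := by
    rw [hUm]
    refine ⟨fun x hx v => rfl, fun x hx v => ?_⟩
    rw [quot_P, hP'', hPP, quot_act]
  have hU0 : U ≠ ⊥ := by
    intro h
    rw [h, Submodule.mem_bot] at hmk
    apply hKne
    rw [← Submodule.ker_mkQ K, hmk, LinearMap.ker_zero]
  have hUinv : QAct.Invt n B κ U := by
    have hodd : ∀ y : ↥(qA n B), IsOddElt n B ↑y → ∀ f ∈ U, κ.act y f ∈ U := by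
      intro y hy f hf
      rw [hUm] at *
      refine ⟨fun x hx v => ?_, fun x hx v => ?_⟩
      · rw [homR_act, homR_act, hc1 _ _ (Or.inr hx), hf.1 x hx]
      · rw [homR_act, homR_act, hc2 _ _ hy hx, map_neg, hf.2 x hx, ← hP', r'.Pod y hy]
        simp
    have hev : ∀ y : ↥(qA n B), IsEvenElt n B ↑y → ∀ f ∈ U, κ.act y f ∈ U := by
      intro y hy f hf
      rw [hUm] at *
      refine ⟨fun x hx v => ?_, fun x hx v => ?_⟩
      · rw [homR_act, homR_act, hc1 _ _ (Or.inl hy), hf.1 x hx]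
      · rw [homR_act, homR_act, hc1 _ _ (Or.inl hy), hf.2 x hx, ← hP', r'.Pev y hy]
    constructor
    · intro y f hf
      rw [act_split]
      exact U.add_mem (hev _ (isEven_evenPartL n B y) f hf) (hodd _ (isOdd_oddPartL n B y) f hf)
    · intro f hf
      rw [hUm] at *
      refine ⟨fun x hx v => ?_, fun x hx v => ?_⟩
      · rw [homR_P, homR_P, hP', ← hP'', r''.Pev x hx, hf.1 x hx, rσ.Pev x hx]
      · rw [homR_P, homR_P, hP', ← hP'', r''.Pod x hx, map_neg, hf.2 x hx, map_neg, rσ.Pod x hx,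
          rσ.PP, hP'']
        simp only [neg_neg, hPP]
        rw [rσ.PP]
  obtain ⟨S, hSU, hS⟩ := exists_irredSub n κ U hUinv hU0
  set κS := QAct.sub n B κ S hS.2.1 with hκS
  have iκ : QAct.Irred n B κS := sub_irred n hS
  have rX : RepFacts n B (QAct.dual n κS) := by
    constructor
    · intro ξ
      ext s
      rw [dual_P, dual_P]
      congr 1
      apply Subtype.ext
      ext v
      rw [sub_P, sub_P, homR_P, homR_P, rσ.PP, r'.PP]
    · intro x hx ξ
      ext s
      rw [dual_P, dual_act, dual_act, dual_P]
      congr 1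
      apply Subtype.ext
      ext v
      simp only [hκS, hκ, sub_act, sub_P, homR_P, homR_act, r'.Pev x hx]
    · intro x hx ξ
      ext s
      rw [dual_P, LinearMap.neg_apply, dual_act, dual_act, dual_P, ← map_neg]
      congr 1
      apply Subtype.ext
      ext v
      rw [sub_act, homR_act, sub_P, homR_P, Submodule.coe_neg, LinearMap.neg_apply, sub_P,
        homR_P, sub_act, homR_act, r'.Pod x hx, map_neg, map_neg]
    · intro x y hxy ξ
      ext s
      rw [LinearMap.sub_apply, dual_act, dual_act, dual_act, dual_act, dual_act, ← map_sub]
      congr 1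
      apply Subtype.ext
      ext v
      rw [sub_act, homR_act, r'.bre x y hxy, Submodule.coe_sub, LinearMap.sub_apply, map_sub]
      rfl
    · intro x y hx hy ξ
      ext s
      rw [LinearMap.add_apply, dual_act, dual_act, dual_act, dual_act, dual_act, ← map_add]
      congr 1
      apply Subtype.ext
      ext v
      rw [sub_act, homR_act, r'.bro x y hx hy, Submodule.coe_add, LinearMap.add_apply, map_add]
      rfl
  obtain ⟨φ, hφx, hφP, hφ0⟩ := phi_exists n κS σ ρ S.subtype (by
    intro x s v
    have hs := (hUm _).1 (hSU s.2)
    change (s : M →ₗ[ℂ] M ⧸ K) (ρ.act x v) = (s : M →ₗ[ℂ] M ⧸ K) (ρ'.act x v) +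
      σ.act (evenPartL n B x) ((s : M →ₗ[ℂ] M ⧸ K) v) +
      σ.act (oddPartL n B x) (σ.P ((s : M →ₗ[ℂ] M ⧸ K) (ρ'.P v)))
    rw [hsum, map_add, add_assoc]
    congr 1
    rw [act_split, map_add, hs.1 _ (isEven_evenPartL n B x), hs.2 _ (isOdd_oddPartL n B x), hP'])
    (by
    intro s v
    change (s : M →ₗ[ℂ] M ⧸ K) (ρ.P v) = σ.P (σ.P ((s : M →ₗ[ℂ] M ⧸ K) (ρ'.P v)))
    rw [rσ.PP, hP'])
  refine ⟨⟨Module.Dual ℂ S, QAct.dual n κS⟩, ⟨M ⧸ K, σ⟩, rX, rσ, dual_irred n iκ, iσ,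
    inferInstanceAs (FiniteDimensional ℂ (Module.Dual ℂ S)),
    inferInstanceAs (FiniteDimensional ℂ (M ⧸ K)), ?_, ?_, ?_, φ, ?_, hφx, hφP⟩
  · intro x hx
    ext ξ s
    change ξ (κS.act x s) = 0
    have : κS.act x s = 0 := by
      apply Subtype.ext
      ext v
      rw [sub_act, homR_act, hx]
      simp
    rw [this, map_zero]
  · intro x hx
    apply LinearMap.ext
    intro v
    obtain ⟨v, rfl⟩ := K.mkQ_surjective v
    change σ.act x (K.mkQ v) = 0
    rw [quot_act, hx, LinearMap.zero_apply, map_zero]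
  · intro htriv
    let L : Submodule ℂ M := Submodule.span ℂ {w | ∃ x v, ρ''.act x v = w}
    have hmem : ∀ x v, ρ''.act x v ∈ L := fun x v => Submodule.subset_span ⟨x, v, rfl⟩
    have hLK : L ≤ K := by
      refine Submodule.span_le.2 ?_
      rintro _ ⟨x, v, rfl⟩
      have h1 : σ.act x (K.mkQ v) = 0 := LinearMap.congr_fun (htriv x) (K.mkQ v)
      rw [quot_act] at h1
      exact (Submodule.Quotient.mk_eq_zero K).1 h1
    have hst : ∀ (T : M →ₗ[ℂ] M), (∀ x v, T (ρ''.act x v) ∈ L) → ∀ w ∈ L, T w ∈ L := by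
      intro T hT
      change L ≤ L.comap T
      refine Submodule.span_le.2 ?_
      rintro _ ⟨x, v, rfl⟩
      exact hT x v
    have hLinv : QAct.Invt n B ρ L := by
      constructor
      · intro y
        refine hst _ fun x v => ?_
        rw [hsum]
        refine L.add_mem ?_ (hmem _ _)
        rw [act_split n B ρ' y, act_split n B ρ'' x, map_add, map_add,
          hc1 _ _ (Or.inl (isEven_evenPartL n B y)), hc1 _ _ (Or.inl (isEven_evenPartL n B y)),
          hc1 _ _ (Or.inr (isEven_evenPartL n B x)),
          hc2 _ _ (isOdd_oddPartL n B y) (isOdd_oddPartL n B x)]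
        exact L.add_mem (L.add_mem (hmem _ _) (hmem _ _))
          (L.add_mem (hmem _ _) (L.neg_mem (hmem _ _)))
      · refine hst _ fun x v => ?_
        rw [← hP'', r''.P_act]
        exact L.sub_mem (hmem _ _) (hmem _ _)
    have hLbot : L = ⊥ := by
      refine (hirr.2 L hLinv).resolve_right fun h => hKne ?_
      rw [← top_le_iff, ← h]
      exact hLK
    intro x
    ext v
    have := hmem x v
    rwa [hLbot, Submodule.mem_bot] at this
  · rw [← LinearMap.ker_eq_bot]
    refine (hirr.2 _ ⟨?_, ?_⟩).resolve_right ?_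
    · intro x v hv
      rw [LinearMap.mem_ker] at *
      rw [hφx, hv, map_zero]
    · intro v hv
      rw [LinearMap.mem_ker] at *
      rw [hφP, hv, map_zero]
    · intro htop
      apply hS.1
      rw [eq_bot_iff]
      intro s hs
      rw [Submodule.mem_bot]
      ext v
      have hv : φ v = 0 := by
        rw [← LinearMap.mem_ker, htop]; trivial
      exact hφ0 v hv ⟨s, hs⟩

/-! ### Existence of evaluation data -/

/-- An equivariant embedding, commuting with the parity up to a global sign. -/
def Emb (V T : QModB n B) : Prop :=
  ∃ (φ : V.M →ₗ[ℂ] T.M) (ε : ℂ), Function.Injective φ ∧ (ε = 1 ∨ ε = -1) ∧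
    (∀ x v, φ (V.ρ.act x v) = T.ρ.act x (φ v)) ∧ ∀ v, φ (V.ρ.P v) = ε • T.ρ.P (φ v)

lemma emb_tens {V X Y T : QModB n B} (hY : RepFacts n B Y.ρ)
    (hV : ∃ φ : V.M →ₗ[ℂ] X.M ⊗[ℂ] Y.M, Function.Injective φ ∧
        (∀ x v, φ (V.ρ.act x v) = tActL n B X.ρ Y.ρ x (φ v)) ∧
        ∀ v, φ (V.ρ.P v) = TensorProduct.map X.ρ.P Y.ρ.P (φ v))
    (hX : Emb n X T) : Emb n V (tensQ n T Y) := by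
  obtain ⟨φ, hφ, ha, hp⟩ := hV
  obtain ⟨φ', ε, hφ', hε, ha', hp'⟩ := hX
  obtain ⟨ψ, hψ, he, ho, hP⟩ : ∃ ψ : Y.M →ₗ[ℂ] Y.M, Function.Injective ψ ∧
      (∀ x : ↥(qA n B), IsEvenElt n B ↑x → ∀ v, ψ (Y.ρ.act x v) = Y.ρ.act x (ψ v)) ∧
      (∀ x : ↥(qA n B), IsOddElt n B ↑x → ∀ v, ε • ψ (Y.ρ.act x v) = Y.ρ.act x (ψ v)) ∧
      (∀ v, ψ (Y.ρ.P v) = Y.ρ.P (ψ v)) := by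
    rcases hε with rfl | rfl
    · exact ⟨LinearMap.id, fun _ _ h => h, fun _ _ _ => rfl, fun _ _ _ => one_smul _ _,
        fun _ => rfl⟩
    · refine ⟨Y.ρ.P, fun a b h => ?_, hY.Pev, fun x hx v => ?_, fun _ => rfl⟩
      · rw [← hY.PP a, h, hY.PP]
      · rw [hY.Pod x hx, neg_smul, one_smul, neg_neg]
  have key : ∀ x w, TensorProduct.map φ' ψ (tActL n B X.ρ Y.ρ x w) =
      tActL n B T.ρ Y.ρ x (TensorProduct.map φ' ψ w) := by
    intro x w
    induction w with
    | zero => simp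
    | add v w hv hw => simp only [map_add, hv, hw]
    | tmul u v =>
      rw [tActL_tmul, TensorProduct.map_tmul, tActL_tmul]
      simp only [map_add, TensorProduct.map_tmul, ha', hp', he _ (isEven_evenPartL n B x),
        ← ho _ (isOdd_oddPartL n B x), TensorProduct.smul_tmul]
  have keyP : ∀ w, TensorProduct.map φ' ψ (TensorProduct.map X.ρ.P Y.ρ.P w) =
      ε • TensorProduct.map T.ρ.P Y.ρ.P (TensorProduct.map φ' ψ w) := by
    intro w
    induction w with
    | zero => simp
    | add v w hv hw => simp only [map_add, hv, hw, smul_add]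
    | tmul u v =>
      simp only [TensorProduct.map_tmul, hp', hP, TensorProduct.smul_tmul']
  refine ⟨TensorProduct.map φ' ψ ∘ₗ φ, ε, ?_, hε, ?_, ?_⟩
  · have h1 : Function.Injective (TensorProduct.map φ' ψ) :=
      TensorProduct.map_injective_of_flat_flat φ' ψ hφ' hψ
    exact h1.comp hφ
  · intro x v
    exact (congrArg _ (ha x v)).trans (key x (φ v))
  · intro v
    exact (congrArg _ (hp v)).trans (keyP (φ v))

lemma emb_triv {V : QModB n B} (hr : RepFacts n B V.ρ) (hi : QAct.Irred n B V.ρ)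
    (ht : ∀ x, V.ρ.act x = 0) : Emb n V (trivQ n) := by
  obtain ⟨hnt, hirr⟩ := hi
  obtain ⟨w, ε, hw, hε, hP⟩ : ∃ (w : V.M) (ε : ℂ), w ≠ 0 ∧ (ε = 1 ∨ ε = -1) ∧
      V.ρ.P w = ε • w := by
    obtain ⟨u, hu⟩ := exists_ne (0 : V.M)
    by_cases h : u + V.ρ.P u = 0
    · exact ⟨u, -1, hu, Or.inr rfl, by rw [neg_smul, one_smul]; exact eq_neg_of_add_eq_zero_right h⟩
    · exact ⟨u + V.ρ.P u, 1, h, Or.inl rfl, by rw [map_add, hr.PP, one_smul, add_comm]⟩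
  have htop : Submodule.span ℂ {w} = ⊤ := by
    refine (hirr _ ⟨?_, ?_⟩).resolve_left ?_
    · intro x m _
      rw [ht, LinearMap.zero_apply]
      exact zero_mem _
    · intro m hm
      obtain ⟨a, rfl⟩ := Submodule.mem_span_singleton.1 hm
      rw [map_smul, hP]
      exact Submodule.smul_mem _ _ (Submodule.smul_mem _ _ (Submodule.mem_span_singleton_self w))
    · simpa using hw
  have hall : ∀ v : V.M, ∃ a : ℂ, a • w = v := fun v =>
    Submodule.mem_span_singleton.1 (htop ▸ Submodule.mem_top)
  let e : ℂ →ₗ[ℂ] V.M := LinearMap.toSpanSingleton ℂ V.M w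
  have he : Function.Bijective e := by
    constructor
    · intro a b hab
      exact smul_left_injective ℂ hw hab
    · intro v
      exact hall v
  let E := LinearEquiv.ofBijective e he
  refine ⟨E.symm.toLinearMap, ε, E.symm.injective, hε, ?_, ?_⟩
  · intro x v
    rw [ht, LinearMap.zero_apply]
    exact map_zero E.symm
  · intro v
    obtain ⟨a, rfl⟩ := hall v
    have h1 : V.ρ.P (a • w) = ε • (a • w) := by
      rw [map_smul, hP, smul_comm]
    rw [h1]
    exact map_smul E.symm ε (a • w)

lemma exists_data (s : Finset (Ideal B)) : (∀ m ∈ s, m.IsMaximal) → ∀ V : QModB n B,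
    RepFacts n B V.ρ → QAct.Irred n B V.ρ → FiniteDimensional ℂ V.M →
    (∀ x : ↥(qA n B), EntriesIn n B (s.inf id) ↑x → V.ρ.act x = 0) →
    ∃ (k : ℕ) (ms : Fin k → Ideal B) (Vs : Fin k → QModB n B),
      GoodData n k ms Vs ∧ (∀ i, ms i ∈ s) ∧ Emb n V (itTens n k Vs) := by
  classical
  induction s using Finset.induction_on with
  | empty =>
    intro _ V hr hi _ hk
    refine ⟨0, Fin.elim0, Fin.elim0, ⟨fun i => i.elim0, fun i => i.elim0, fun i => i.elim0⟩,
      fun i => i.elim0, ?_⟩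
    exact emb_triv n hr hi fun x => hk x fun i j => by simp
  | insert m s hms ih =>
    intro hmax V hr hi hfd hk
    have hmm : m.IsMaximal := hmax m (Finset.mem_insert_self _ _)
    have hss : ∀ J ∈ s, J.IsMaximal := fun J hJ => hmax J (Finset.mem_insert_of_mem hJ)
    obtain ⟨d, hd, hdm⟩ := exists_sep m hmm s
      (fun J hJ => ⟨hss J hJ, fun h => hms (h ▸ hJ)⟩)
    have hdJ : d ∈ s.inf id := by
      rw [Submodule.mem_finsetInf]
      exact hd
    rw [Finset.inf_insert, id_eq] at hk
    set J := s.inf id with hJdef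
    obtain ⟨c, hc⟩ : ∃ c, c = 1 - d := ⟨_, rfl⟩
    rw [← hc] at hdm
    have hcd : ∀ x, V.ρ.act (bs n (c * d) x) = 0 := fun x =>
      hk _ (bs_entries n (m ⊓ J) ⟨m.mul_mem_right _ hdm, J.mul_mem_left _ hdJ⟩ x)
    have hsum : ∀ x, V.ρ.act x = V.ρ.act (bs n c x) + V.ρ.act (bs n d x) := by
      intro x
      rw [← map_add, ← bs_add, hc, sub_add_cancel, bs_one]
    have hcc : ∀ x, V.ρ.act (bs n (c * c) x) = V.ρ.act (bs n c x) := by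
      intro x
      have : c * c = c - c * d := by rw [hc]; ring
      rw [this, bs_sub, map_sub, hcd, sub_zero]
    have hdd : ∀ x, V.ρ.act (bs n (d * d) x) = V.ρ.act (bs n d x) := by
      intro x
      have : d * d = d - c * d := by rw [hc]; ring
      rw [this, bs_sub, map_sub, hcd, sub_zero]
    have hbr : ∀ x y v, V.ρ.act (brs n (bs n c x) (bs n d y)) v = 0 := by
      intro x y v
      rw [bs_brs, hcd, LinearMap.zero_apply]
    obtain ⟨X, Y, rX, rY, iX, iY, fX, fY, kX, kY, tY, hφ⟩ :=
      split_lemma n V.ρ (QAct.tw n V.ρ c) (QAct.tw n V.ρ d) (hr.tw n c hcc) (hr.tw n d hdd)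
        rfl rfl (fun x v => by rw [hsum]; rfl)
        (fun x y hxy v => by
          have h := hr.bre (bs n c x) (bs n d y) (hxy.imp (bs_even n c) (bs_even n d)) v
          rw [hbr] at h
          exact sub_eq_zero.1 h.symm)
        (fun x y hx hy v => by
          have h := hr.bro (bs n c x) (bs n d y) (bs_odd n c hx) (bs_odd n d hy) v
          rw [hbr] at h
          exact eq_neg_of_add_eq_zero_left h.symm) hi
    have hcJ : ∀ x : ↥(qA n B), EntriesIn n B J ↑x → V.ρ.act (bs n c x) = 0 :=
      fun x hx => hk _ (bs_entries' n m J hdm x hx)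
    by_cases hT : TrivialActs n Y
    · obtain ⟨k, ms, Vs, hg, hin, hE⟩ := ih hss V hr hi hfd (fun x hx => by
        rw [hsum, hcJ x hx, zero_add]
        exact tY hT x)
      exact ⟨k, ms, Vs, hg, fun i => Finset.mem_insert_of_mem (hin i), hE⟩
    · obtain ⟨k, ms, Vs, hg, hin, hE⟩ := ih hss X rX iX fX (fun x hx => kX x (hcJ x hx))
      have hYm : SuppAt n m Y := fun x hx => kY x (hk _ (by
        rw [inf_comm]
        exact bs_entries' n J m hdJ x hx))
      refine ⟨k + 1, Fin.snoc (α := fun _ => Ideal B) ms m,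
        Fin.snoc (α := fun _ => QModB n B) Vs Y, ⟨?_, ?_, ?_⟩, ?_, ?_⟩
      · intro i
        refine Fin.lastCases ?_ (fun i => ?_) i
        · simpa using hmm
        · simpa using hg.1 i
      · intro i j
        refine Fin.lastCases ?_ (fun i => ?_) i <;> refine Fin.lastCases ?_ (fun j => ?_) j
        · simp
        · simp only [Fin.snoc_last, Fin.snoc_castSucc]
          intro h
          exact absurd (h ▸ hin j) hms
        · simp only [Fin.snoc_last, Fin.snoc_castSucc]
          intro h
          exact absurd (h ▸ hin i) hms
        · simp only [Fin.snoc_castSucc]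
          intro h
          rw [hg.2.1 h]
      · intro i
        refine Fin.lastCases ?_ (fun i => ?_) i
        · rw [Fin.snoc_last, Fin.snoc_last]
          exact ⟨(repFacts_iff n B _).2 rY, iY, fY, hYm, hT⟩
        · rw [Fin.snoc_castSucc, Fin.snoc_castSucc]
          exact hg.2.2 i
      · intro i
        refine Fin.lastCases ?_ (fun i => ?_) i
        · simp
        · simpa using Or.inr (hin i)
      · have e : itTens n (k + 1) (Fin.snoc (α := fun _ => QModB n B) Vs Y) =
            tensQ n (itTens n k Vs) Y := by
          simp [itTens]
        rw [e]
        exact emb_tens n rY hφ hE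

/-- Part two of the theorem. -/
lemma part_two (hn : 2 ≤ n) [Algebra.FiniteType ℂ B] (V : QModB n B)
    (hr : QAct.IsRep n B V.ρ) (hi : QAct.Irred n B V.ρ) (hf : FiniteDimensional ℂ V.M) :
      ∃ (k : ℕ) (ms : Fin k → Ideal B) (Vs : Fin k → QModB n B),
        GoodData n k ms Vs ∧ Matches n k ms Vs V := by
  have hr' := (repFacts_iff n B _).1 hr
  obtain ⟨s, hs, hle⟩ := annI_inf n hn hr' hi
  obtain ⟨k, ms, Vs, hg, -, φ, ε, hφ, hε, ha, hp⟩ := exists_data n s hs V hr' hi hf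
    (fun x hx => annI_kill n V.ρ x fun i j => ⟨hle (hx i j).1, hle (hx i j).2⟩)
  have hεε : ε * ε = 1 := by rcases hε with rfl | rfl <;> norm_num
  have hp2 : ∀ v, (itTens n k Vs).ρ.P (φ v) = φ (ε • V.ρ.P v) := by
    intro v
    rw [map_smul, hp, smul_smul, hεε, one_smul]
  refine ⟨k, ms, Vs, hg, LinearMap.range φ, ⟨?_, ⟨?_, ?_⟩, ?_⟩, φ, hφ, rfl, ha⟩
  · intro h
    rw [LinearMap.range_eq_bot] at h
    have := hi.1
    obtain ⟨u, hu⟩ := exists_ne (0 : V.M)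
    exact hu (hφ (by rw [h]; simp))
  · rintro x _ ⟨v, rfl⟩
    exact ⟨_, ha x v⟩
  · rintro _ ⟨v, rfl⟩
    exact ⟨_, (hp2 v).symm⟩
  · intro W' hW' hinv
    have hcm : (W'.comap φ).map φ = W' := by
      rw [Submodule.map_comap_eq, inf_eq_right.2 hW']
    rcases hi.2 (W'.comap φ) ⟨fun x v hv => by
        rw [Submodule.mem_comap, ha]
        exact hinv.1 x _ hv, fun v hv => by
        rw [Submodule.mem_comap, hp]
        exact Submodule.smul_mem _ _ (hinv.2 _ hv)⟩ with h | h
    · left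
      rw [← hcm, h, Submodule.map_bot]
    · right
      rw [← hcm, h, Submodule.map_top]
/-- Classification of the irreducible finite-dimensional representations of
`𝔮(n) ⊗ A` (`n ≥ 2`, `A` a finitely generated commutative unital `ℂ`-algebra): the
assignment `Ψ ↦ êv_Ψ` is a bijection from the set `𝓔(𝔮, A)` of finitely supported
functions `MaxSpec(A) → 𝓡(𝔮)` to the set of isomorphism classes of irreducible
finite-dimensional representations of `𝔮(n) ⊗ A`.  Concretely: every evaluation
datum gives rise to an irreducible finite-dimensional module (and all irreducible
submodules used are isomorphic, by irreducibility); every irreducible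
finite-dimensional module arises this way; and two data giving isomorphic modules
agree up to permutation, so in particular all irreducible finite-dimensional
representations are irreducible products of evaluation representations. -/
theorem classification_untwisted (hn : 2 ≤ n) [Algebra.FiniteType ℂ B] :
    (∀ (k : ℕ) (ms : Fin k → Ideal B) (Vs : Fin k → QModB n B),
      GoodData n k ms Vs →
      ∃ V : QModB n B, QAct.IsRep n B V.ρ ∧ QAct.Irred n B V.ρ ∧
        FiniteDimensional ℂ V.M ∧ Matches n k ms Vs V) ∧
    (∀ V : QModB n B, QAct.IsRep n B V.ρ → QAct.Irred n B V.ρ →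
      FiniteDimensional ℂ V.M →
      ∃ (k : ℕ) (ms : Fin k → Ideal B) (Vs : Fin k → QModB n B),
        GoodData n k ms Vs ∧ Matches n k ms Vs V) ∧
    (∀ (k : ℕ) (ms : Fin k → Ideal B) (Vs : Fin k → QModB n B)
        (k' : ℕ) (ms' : Fin k' → Ideal B) (Vs' : Fin k' → QModB n B)
        (V V' : QModB n B),
      GoodData n k ms Vs → GoodData n k' ms' Vs' →
      Matches n k ms Vs V → Matches n k' ms' Vs' V' →
      QModIso n V V' →
      ∃ σ : Fin k ≃ Fin k', (∀ i, ms' (σ i) = ms i) ∧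
        ∀ i, QModIso n (Vs i) (Vs' (σ i))) := by
  exact ⟨fun k ms Vs hg => part_one n k ms Vs hg, fun V hr hi hf => part_two n hn V hr hi hf,
    fun k ms Vs k' ms' Vs' V V' hg hg' hm hm' e =>
      part_three n k ms Vs k' ms' Vs' V V' hg hg' hm hm' e⟩
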